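/- arXiv:2210.13080 — 17 statements merged into one kernel-verified Lean document; each statement's English description precedes it below -/
import Mathlib

section
/- There exists a primitive recursive function W : ℕ × ℕ → List ℕ such that, defining for each n the set U n = { f : ℕ → ℕ | ∃ s, W (n, s) is an initial segment of f }, every U n is a dense open subset of Baire space ℕ → ℕ, and no primitive recursive function lies in the intersection of all the U n: for every primitive recursive f : ℕ → ℕ there is an n with f ∉ U n. -/
/-- `σ` is an initial segment of `f`: `f i` equals the `i`-th entry of `σ`
for every `i < σ.length`. -/
def IsInitialSegment (σ : List ℕ) (f : ℕ → ℕ) : Prop :=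
  ∀ i : Fin σ.length, σ.get i = f i

/-- For `n` coding `(m, v)` and `s` coding `(σ, t)`, the string `σ` extended by `ack m σ.length` if
this value is computed within `t` steps, and the default string `[v]` otherwise. -/
def ackExtension (p : ℕ × ℕ) : List ℕ :=
  ((Nat.Partrec.Code.evaln (Denumerable.ofNat (List ℕ × ℕ) p.2).2
      (Nat.Partrec.Code.pappAck p.1.unpair.1)
      (Denumerable.ofNat (List ℕ × ℕ) p.2).1.length).map
    fun y => (Denumerable.ofNat (List ℕ × ℕ) p.2).1 ++ [y]).getD [p.1.unpair.2]

theorem primrec_ackExtension : Primrec ackExtension := by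
  have hs : Primrec fun p : ℕ × ℕ => Denumerable.ofNat (List ℕ × ℕ) p.2 :=
    (Primrec.ofNat _).comp Primrec.snd
  have hn : Primrec fun p : ℕ × ℕ => p.1.unpair := Primrec.unpair.comp Primrec.fst
  have hσ := Primrec.fst.comp hs
  have hcode := Nat.Partrec.Code.primrec_pappAck.comp (Primrec.fst.comp hn)
  refine Primrec.option_getD.comp (Primrec.option_map (Nat.Partrec.Code.primrec_evaln.comp
    (((Primrec.snd.comp hs).pair hcode).pair (Primrec.list_length.comp hσ))) ?_)
    (Primrec.list_cons.comp (Primrec.snd.comp hn) (Primrec.const []))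
  exact Primrec.list_concat.comp (hσ.comp Primrec.fst) Primrec.snd

/-- Every value of `ackExtension` is either the default string or ends in an Ackermann value. -/
theorem ackExtension_eq_or (m v s : ℕ) :
    ackExtension (Nat.pair m v, s) = [v] ∨
      ∃ σ : List ℕ, ackExtension (Nat.pair m v, s) = σ ++ [ack m σ.length] := by
  rcases h : Denumerable.ofNat (List ℕ × ℕ) s with ⟨σ, t⟩
  rcases hy : Nat.Partrec.Code.evaln t (Nat.Partrec.Code.pappAck m) σ.length with _ | y
  · left
    simp only [ackExtension, Nat.unpair_pair, h, hy, Option.map_none, Option.getD_none]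
  · right
    have hack := Nat.Partrec.Code.evaln_sound (Option.mem_def.2 hy)
    rw [Nat.Partrec.Code.eval_pappAck, Part.mem_some_iff] at hack
    refine ⟨σ, ?_⟩
    simp only [ackExtension, Nat.unpair_pair, h, hy, hack, Option.map_some, Option.getD_some]

theorem exists_ackExtension_eq (n : ℕ) (σ : List ℕ) :
    ∃ s, ackExtension (n, s) = σ ++ [ack n.unpair.1 σ.length] := by
  have hmem : ack n.unpair.1 σ.length ∈
      (Nat.Partrec.Code.pappAck n.unpair.1).eval σ.length := by simp
  obtain ⟨t, ht⟩ := Nat.Partrec.Code.evaln_complete.1 hmem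
  refine ⟨Encodable.encode (σ, t), ?_⟩
  rw [Option.mem_def] at ht
  simp only [ackExtension, Denumerable.ofNat_encode, ht, Option.map_some, Option.getD_some]

theorem isOpen_setOf_isInitialSegment (σ : List ℕ) : IsOpen {f | IsInitialSegment σ f} := by
  simp only [IsInitialSegment, Set.ofPred_forall]
  exact isOpen_iInter_of_finite fun i =>
    (isOpen_discrete {k | σ.get i = k}).preimage (continuous_apply (i : ℕ))

/-- A set meeting the cylinder of every finite string is dense in Baire space. -/
theorem dense_of_forall_isInitialSegment {S : Set (ℕ → ℕ)}
    (h : ∀ σ : List ℕ, ∃ f ∈ S, IsInitialSegment σ f) : Dense S := by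
  rw [(PiNat.isTopologicalBasis_cylinders fun _ => ℕ).dense_iff]
  rintro _ ⟨x, n, rfl⟩ -
  obtain ⟨f, hfS, hf⟩ := h ((List.range n).map x)
  refine ⟨f, fun i hi => ?_, hfS⟩
  simpa using (hf ⟨i, by simpa using hi⟩).symm

theorem isInitialSegment_getD (σ : List ℕ) : IsInitialSegment σ fun i => σ.getD i 0 := by
  intro i
  simp

theorem IsInitialSegment.of_append {σ τ : List ℕ} {f : ℕ → ℕ}
    (h : IsInitialSegment (σ ++ τ) f) : IsInitialSegment σ f := by
  intro i
  have hi := i.isLt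
  simpa [List.getElem_append_left hi] using h ⟨i, by simp; lia⟩

theorem IsInitialSegment.apply_length {σ : List ℕ} {a : ℕ} {f : ℕ → ℕ}
    (h : IsInitialSegment (σ ++ [a]) f) : f σ.length = a := by
  simpa using (h ⟨σ.length, by simp⟩).symm

theorem stmt0 :
    ∃ W : ℕ × ℕ → List ℕ, Primrec W ∧
      (∀ n : ℕ, IsOpen {f : ℕ → ℕ | ∃ s, IsInitialSegment (W (n, s)) f}) ∧
      (∀ n : ℕ, Dense {f : ℕ → ℕ | ∃ s, IsInitialSegment (W (n, s)) f}) ∧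
      (∀ f : ℕ → ℕ, Primrec f →
        ∃ n, f ∉ {g : ℕ → ℕ | ∃ s, IsInitialSegment (W (n, s)) g}) := by
  refine ⟨ackExtension, primrec_ackExtension, fun n => ?_, fun n => ?_, fun f hf => ?_⟩
  · rw [Set.ofPred_exists]
    exact isOpen_iUnion fun s => isOpen_setOf_isInitialSegment _
  · refine dense_of_forall_isInitialSegment fun σ => ?_
    obtain ⟨s, hs⟩ := exists_ackExtension_eq n σ
    have hseg := isInitialSegment_getD (σ ++ [ack n.unpair.1 σ.length])
    exact ⟨_, ⟨s, hs ▸ hseg⟩, hseg.of_append⟩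
  · obtain ⟨m, hm⟩ := exists_lt_ack_of_nat_primrec (Primrec.nat_iff.1 hf)
    refine ⟨Nat.pair m (f 0 + 1), ?_⟩
    rintro ⟨s, hs⟩
    rcases ackExtension_eq_or m (f 0 + 1) s with h | ⟨σ, h⟩
    · rw [h] at hs
      have := IsInitialSegment.apply_length (σ := []) hs
      simp at this
    · rw [h] at hs
      exact (hm σ.length).ne hs.apply_length
end

section
/- For every computable T : List Bool → Bool which is a tree (i.e., T σ = true whenever T τ = true and σ is a prefix of τ), there exists a primitive recursive tree T̂ : List Bool → Bool having exactly the same infinite paths: for every f : ℕ → Bool, (∀ n, T (f↾n) = true) ↔ (∀ n, T̂ (f↾n) = true). -/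
/-- `f↾n`, the list `[f 0, f 1, …, f (n-1)]`. -/
def restrictFun (f : ℕ → Bool) (n : ℕ) : List Bool :=
  List.ofFn fun i : Fin n => f i

theorem restrictFun_take (f : ℕ → Bool) {m n : ℕ} (h : m ≤ n) :
    (restrictFun f n).take m = restrictFun f m := by
  apply List.ext_getElem
  · simp [restrictFun, h]
  · intro i h₁ h₂
    simp [restrictFun]

/-- Every total computable function is computed, on encoded inputs, by some code. -/
theorem Computable.exists_code {α β : Type*} [Primcodable α] [Primcodable β] {f : α → β}
    (hf : Computable f) : ∃ c : Nat.Partrec.Code,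
      ∀ a, c.eval (Encodable.encode a) = Part.some (Encodable.encode (f a)) := by
  obtain ⟨c, hc⟩ := Nat.Partrec.Code.exists_code.1 hf
  refine ⟨c, fun a => ?_⟩
  simp [hc]

/-- No prefix of `σ` is rejected by the code `c` within `σ.length` steps. -/
def NoPrefixRejected (c : Nat.Partrec.Code) (σ : List Bool) : Prop :=
  ∀ m < σ.length + 1,
    ¬ c.evaln σ.length (Encodable.encode (σ.take m)) = some (Encodable.encode false)

theorem primrecPred_noPrefixRejected (c : Nat.Partrec.Code) :
    PrimrecPred (NoPrefixRejected c) := by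
  have hrel : PrimrecRel fun (m : ℕ) (σ : List Bool) =>
      ¬ c.evaln σ.length (Encodable.encode (σ.take m)) = some (Encodable.encode false) := by
    refine PrimrecPred.not (Primrec.eq.comp ?_ (Primrec.const _))
    exact Nat.Partrec.Code.primrec_evaln.comp
      (((Primrec.list_length.comp Primrec.snd).pair (Primrec.const c)).pair
        (Primrec.encode.comp (Primrec.list_take.comp Primrec.fst Primrec.snd)))
  refine (hrel.forall_mem_list.comp (Primrec.list_range.comp
    (Primrec.succ.comp Primrec.list_length)) Primrec.id).of_eq fun σ => ?_
  simp [NoPrefixRejected]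

theorem NoPrefixRejected.of_prefix {c : Nat.Partrec.Code} {σ τ : List Bool} (h : σ <+: τ)
    (hτ : NoPrefixRejected c τ) : NoPrefixRejected c σ := by
  intro m hm he
  have hle := h.length_le
  refine hτ m (by lia) ?_
  have htake : τ.take m = σ.take m := by
    obtain ⟨ρ, rfl⟩ := h
    exact List.take_append_of_le_length (by lia)
  rw [htake]
  exact Nat.Partrec.Code.evaln_mono hle he

theorem forall_noPrefixRejected_iff {T : List Bool → Bool} {c : Nat.Partrec.Code}
    (hc : ∀ σ, c.eval (Encodable.encode σ) = Part.some (Encodable.encode (T σ)))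
    (f : ℕ → Bool) :
    (∀ n, NoPrefixRejected c (restrictFun f n)) ↔ ∀ n, T (restrictFun f n) = true := by
  have hlen (n : ℕ) : (restrictFun f n).length = n := by simp [restrictFun]
  constructor
  · intro h n
    by_contra hn
    have hmem : Encodable.encode false ∈ c.eval (Encodable.encode (restrictFun f n)) := by
      rw [hc, Bool.eq_false_of_not_eq_true hn]
      exact Part.mem_some _
    obtain ⟨k, hk⟩ := Nat.Partrec.Code.evaln_complete.1 hmem
    refine h (max n k) n (by rw [hlen]; lia) ?_
    rw [hlen, restrictFun_take f (le_max_left n k)]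
    exact Nat.Partrec.Code.evaln_mono (le_max_right n k) hk
  · intro h n m hm he
    rw [hlen] at hm
    rw [restrictFun_take f (by lia)] at he
    have hmem := Nat.Partrec.Code.evaln_sound he
    rw [hc, Part.mem_some_iff, h m] at hmem
    exact absurd (Encodable.encode_injective hmem) (by decide)

theorem stmt2 (T : List Bool → Bool) (hT : Computable T)
    (htree : ∀ σ τ : List Bool, σ <+: τ → T τ = true → T σ = true) :
    ∃ That : List Bool → Bool, Primrec That ∧
      (∀ σ τ : List Bool, σ <+: τ → That τ = true → That σ = true) ∧
      (∀ f : ℕ → Bool,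
        (∀ n, T (restrictFun f n) = true) ↔ (∀ n, That (restrictFun f n) = true)) := by
  obtain ⟨c, hc⟩ := hT.exists_code
  obtain ⟨_, hprim⟩ := primrecPred_noPrefixRejected c
  refine ⟨fun σ => decide (NoPrefixRejected c σ), hprim, fun σ τ h hτ => ?_, fun f => ?_⟩
  · exact decide_eq_true (NoPrefixRejected.of_prefix h (of_decide_eq_true hτ))
  · simpa using (forall_noPrefixRejected_iff hc f).symm
end

section
/- There exists a primitive recursive T : List Bool → Bool which is an infinite tree (downward closed under prefixes and containing strings of every length) such that no computable f : ℕ → Bool is a path through T: for every computable f : ℕ → Bool there is an n with T (f↾n) = false. -/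
open Nat.Partrec (Code)

/-- The tree of strings `σ` such that no entry `σ[e]` is seen, within `σ.length` steps, to be the
output of the `e`-th program on input `e`. -/
def diagonalTree (σ : List Bool) : Bool :=
  decide (∀ e < σ.length,
    Code.evaln σ.length (Denumerable.ofNat Code e) e ≠ σ[e]?.map Encodable.encode)

theorem diagonalTree_eq_true_iff {σ : List Bool} :
    diagonalTree σ = true ↔ ∀ e (h : e < σ.length),
      Code.evaln σ.length (Denumerable.ofNat Code e) e ≠ some (Encodable.encode σ[e]) := by
  rw [diagonalTree, decide_eq_true_iff]
  refine forall₂_congr fun e h => ?_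
  rw [List.getElem?_eq_getElem h, Option.map_some]

theorem primrec_diagonalTree : Primrec diagonalTree := by
  have hR : PrimrecRel fun (e : ℕ) (σ : List Bool) =>
      Code.evaln σ.length (Denumerable.ofNat Code e) e ≠ σ[e]?.map Encodable.encode :=
    (Primrec.eq.comp
      (Code.primrec_evaln.comp <|
        ((Primrec.list_length.comp .snd).pair ((Primrec.ofNat Code).comp .fst)).pair .fst)
      ((Primrec.option_map₁ Primrec.encode).comp <|
        Primrec.list_getElem?.comp .snd .fst)).not
  exact ((hR.forall_mem_list.comp (Primrec.list_range.comp Primrec.list_length)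
    Primrec.id).of_eq fun σ => by simp).decide

theorem diagonalTree_of_prefix {σ τ : List Bool} (h : σ <+: τ) (hτ : diagonalTree τ = true) :
    diagonalTree σ = true := by
  rw [diagonalTree_eq_true_iff] at hτ ⊢
  intro e he heval
  refine hτ e (he.trans_le h.length_le) ?_
  rw [← h.getElem he]
  exact Code.evaln_mono h.length_le heval

theorem exists_mem_diagonalTree (n : ℕ) :
    ∃ σ : List Bool, σ.length = n ∧ diagonalTree σ = true := by
  refine ⟨restrictFun (fun e => decide (Code.evaln n (Denumerable.ofNat Code e) e ≠
    some (Encodable.encode true))) n, List.length_ofFn, ?_⟩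
  rw [diagonalTree_eq_true_iff]
  intro e he heval
  simp only [restrictFun, List.length_ofFn, List.getElem_ofFn] at heval
  by_cases h : Code.evaln n (Denumerable.ofNat Code e) e = some (Encodable.encode true)
  · simp [h] at heval
  · rw [decide_eq_true h] at heval
    exact h heval

theorem exists_restrictFun_notMem_diagonalTree {f : ℕ → Bool} (hf : Computable f) :
    ∃ n, diagonalTree (restrictFun f n) = false := by
  obtain ⟨c, hc⟩ := Code.exists_code.1 (Partrec.nat_iff.1 (Computable.encode.comp hf))
  have hmem : Encodable.encode (f (Encodable.encode c)) ∈ c.eval (Encodable.encode c) := by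
    simp [hc]
  obtain ⟨k, hk⟩ := Code.evaln_complete.1 hmem
  refine ⟨k, Bool.eq_false_iff.2 fun hT => ?_⟩
  refine diagonalTree_eq_true_iff.1 hT (Encodable.encode c) ?_ ?_
  · simpa [restrictFun] using Code.evaln_bound hk
  · simpa [restrictFun] using hk

theorem stmt3 :
    ∃ T : List Bool → Bool, Primrec T ∧
      (∀ σ τ : List Bool, σ <+: τ → T τ = true → T σ = true) ∧
      (∀ n : ℕ, ∃ σ : List Bool, σ.length = n ∧ T σ = true) ∧
      (∀ f : ℕ → Bool, Computable f → ∃ n, T (restrictFun f n) = false) :=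
  ⟨diagonalTree, primrec_diagonalTree, fun _ _ => diagonalTree_of_prefix,
    exists_mem_diagonalTree, fun _ => exists_restrictFun_notMem_diagonalTree⟩
end

section
/- For every computable ρ : ℕ → List Bool with (ρ n).length = n for all n, there exists a primitive recursive σ : ℕ → List Bool with (σ n).length = n for all n such that, for every f : ℕ → Bool, if ρ converges to f then σ converges to f. -/
/-- The sequence of strings `ρ` (with `(ρ n).length = n`) converges to `f`:
for every `i` there is an `N` such that for all `n ≥ N` with `n > i`,
the `i`-th entry of `ρ n` equals `f i`. -/
def StringsConvergeTo (ρ : ℕ → List Bool) (f : ℕ → Bool) : Prop :=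
  ∀ i : ℕ, ∃ N : ℕ, ∀ n : ℕ, N ≤ n → i < n → (ρ n)[i]? = some (f i)

open Nat.Partrec in
/-- A computable function on `ℕ` is the limit of a primitive recursive stagewise approximation
whose defined values are all correct. -/
theorem Computable.exists_primrec_approx {α : Type*} [Primcodable α] {g : ℕ → α}
    (hg : Computable g) :
    ∃ P : ℕ → ℕ → Option α, Primrec₂ P ∧ (∀ s m x, P s m = some x → x = g m) ∧
      ∀ m, ∃ K, ∀ s, K ≤ s → P s m = some (g m) := by
  obtain ⟨c, hc⟩ := Code.exists_code.1 hg
  have heval : ∀ m, Code.eval c m = Part.some (Encodable.encode (g m)) := by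
    intro m
    rw [hc]
    simp
  refine ⟨fun s m => (Code.evaln s c m).bind Encodable.decode, ?_, ?_, ?_⟩
  · exact Primrec.option_bind
      (Code.primrec_evaln.comp
        (Primrec.pair (Primrec.pair Primrec.fst (Primrec.const c)) Primrec.snd))
      (Primrec.decode.comp Primrec.snd)
  · intro s m x h
    obtain ⟨y, hy, hx⟩ := Option.bind_eq_some_iff.1 h
    have hmem := Code.evaln_sound (Option.mem_def.2 hy)
    rw [heval, Part.mem_some_iff] at hmem
    rw [hmem, Encodable.encodek] at hx
    exact (Option.some.inj hx).symm
  · intro m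
    obtain ⟨K, hK⟩ := Code.evaln_complete.1
      (show Encodable.encode (g m) ∈ Code.eval c m by rw [heval]; exact Part.mem_some _)
    refine ⟨K, fun s hs => ?_⟩
    have h := Option.mem_def.1 (Code.evaln_mono hs hK)
    simp [h]

/-- The value `P s m` at the largest `m < k` where it is defined, or `d` if there is none. -/
def lastDefined {α : Type*} (d : α) (P : ℕ → ℕ → Option α) (s k : ℕ) : α :=
  Nat.rec d (fun m acc => (P s m).getD acc) k

theorem primrec_lastDefined {α : Type*} [Primcodable α] (d : α) {P : ℕ → ℕ → Option α}
    (hP : Primrec₂ P) : Primrec₂ (lastDefined d P) :=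
  Primrec.nat_rec' (f := fun p : ℕ × ℕ => p.2) (g := fun _ => d)
    (h := fun p q => (P p.1 q.1).getD q.2) Primrec.snd (Primrec.const d)
    (Primrec.option_getD.comp
      (hP.comp (Primrec.fst.comp Primrec.fst) (Primrec.fst.comp Primrec.snd))
      (Primrec.snd.comp Primrec.snd))

theorem exists_lastDefined_eq {α : Type*} (d : α) {P : ℕ → ℕ → Option α} {g : ℕ → α}
    {s m₀ : ℕ} (hsound : ∀ m x, P s m = some x → x = g m) (hm₀ : P s m₀ = some (g m₀))
    {k : ℕ} (hk : m₀ < k) : ∃ m, m₀ ≤ m ∧ lastDefined d P s k = g m := by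
  induction k, hk using Nat.le_induction with
  | base => exact ⟨m₀, le_rfl, by simp [lastDefined, hm₀]⟩
  | succ k hk ih =>
    cases h : P s k with
    | none => simpa [lastDefined, h] using ih
    | some x => exact ⟨k, by omega, by simp [lastDefined, h, hsound k x h]⟩

theorem stmt4 (ρ : ℕ → List Bool) (hρ : Computable ρ) (hlen : ∀ n, (ρ n).length = n) :
    ∃ σ : ℕ → List Bool, Primrec σ ∧ (∀ n, (σ n).length = n) ∧
      ∀ f : ℕ → Bool, StringsConvergeTo ρ f → StringsConvergeTo σ f := by
  obtain ⟨P, hP, hsound, hlim⟩ := hρ.exists_primrec_approx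
  refine ⟨fun n => (List.range n).map fun i => (lastDefined [] P n n).getD i false,
    ?_, fun n => by simp, ?_⟩
  · exact Primrec.list_map Primrec.list_range
      ((Primrec.list_getD false).comp
        ((primrec_lastDefined [] hP).comp Primrec.fst Primrec.fst) Primrec.snd)
  · intro f hf i
    obtain ⟨N, hN⟩ := hf i
    obtain ⟨K, hK⟩ := hlim (max N (i + 1))
    refine ⟨max K (max N (i + 1) + 1), fun n hn hi => ?_⟩
    obtain ⟨m, hm, hw⟩ := exists_lastDefined_eq [] (hsound n) (hK n (by omega))
      (k := n) (by omega)
    simp [hw, hi, List.getD_eq_getElem?_getD, hN m (by omega) (by omega)]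
end

section
/- Let n ≥ 1 and k ≥ 2. For every computable coloring c : (Fin n → ℕ) → Fin k there exist a primitive recursive coloring ĉ : (Fin n → ℕ) → Fin k and a primitive recursive nondecreasing unbounded function p : ℕ → ℕ such that ĉ x = c (p ∘ x) for every tuple x : Fin n → ℕ for which the values p (x 0), …, p (x (n−1)) are pairwise distinct; consequently, for every infinite H ⊆ ℕ that is homogeneous for ĉ, the image p '' H is infinite and homogeneous for c. -/
/-- `H` is homogeneous for the colouring `c : (Fin n → ℕ) → Fin k`:
there is a colour `j` such that every strictly increasing `n`-tuple with all
values in `H` gets colour `j`. -/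
def HomogeneousFor {n k : ℕ} (c : (Fin n → ℕ) → Fin k) (H : Set ℕ) : Prop :=
  ∃ j : Fin k, ∀ x : Fin n → ℕ, StrictMono x → (∀ i, x i ∈ H) → c x = j

/-- `H ⊆ ℕ` is infinite in the sense of being unbounded. -/
def UnboundedSet (H : Set ℕ) : Prop := ∀ m : ℕ, ∃ t ∈ H, m ≤ t

open Encodable Nat.Partrec

theorem Nat.pair_le_pair {a₁ a₂ b₁ b₂ : ℕ} (ha : a₁ ≤ a₂) (hb : b₁ ≤ b₂) :
    Nat.pair a₁ b₁ ≤ Nat.pair a₂ b₂ :=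
  have left : Nat.pair a₁ b₁ ≤ Nat.pair a₂ b₁ :=
    (StrictMono.monotone (f := fun a => Nat.pair a b₁)
      fun _ _ h => Nat.pair_lt_pair_left b₁ h) ha
  have right : Nat.pair a₂ b₁ ≤ Nat.pair a₂ b₂ :=
    (StrictMono.monotone (f := Nat.pair a₂) fun _ _ h => Nat.pair_lt_pair_right a₂ h) hb
  left.trans right

theorem encode_list_le_of_forall₂ {l₁ l₂ : List ℕ} (h : List.Forall₂ (· ≤ ·) l₁ l₂) :
    encode l₁ ≤ encode l₂ := by
  induction h with
  | nil => exact le_rfl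
  | cons hab _ ih =>
    simp only [encode_list_cons]
    exact Nat.succ_le_succ (Nat.pair_le_pair hab ih)

theorem le_encode_list_of_mem {a : ℕ} {l : List ℕ} (h : a ∈ l) : a ≤ encode l := by
  induction l with
  | nil => simp at h
  | cons b l ih =>
    rw [encode_list_cons]
    rcases List.mem_cons.1 h with rfl | h
    · exact (Nat.left_le_pair _ _).trans (Nat.le_succ _)
    · exact (ih h).trans ((Nat.right_le_pair _ _).trans (Nat.le_succ _))

/-- The code of a tuple for the encoding used by `Primrec` and `Computable`; the default
`Encodable` instance on `Fin n → ℕ` is a different one. -/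
def tupleCode {n : ℕ} (x : Fin n → ℕ) : ℕ :=
  @encode _ Primcodable.toEncodable x

theorem primrec_tupleCode (n : ℕ) : Primrec (tupleCode : (Fin n → ℕ) → ℕ) :=
  Primrec.encode

theorem tupleCode_eq {n : ℕ} (x : Fin n → ℕ) : tupleCode x = encode (List.ofFn x) := by
  rw [← List.Vector.toList_ofFn]
  rfl

theorem monotone_tupleCode (n : ℕ) : Monotone (tupleCode : (Fin n → ℕ) → ℕ) := by
  intro x y h
  rw [tupleCode_eq, tupleCode_eq]
  refine encode_list_le_of_forall₂ (List.forall₂_iff_get.2 ⟨by simp, fun i h₁ h₂ => ?_⟩)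
  simpa using h _

theorem le_tupleCode {n : ℕ} (x : Fin n → ℕ) (i : Fin n) : x i ≤ tupleCode x := by
  rw [tupleCode_eq]
  exact le_encode_list_of_mem (by simp)

/-- Within `s` steps `cd` halts on every code up to that of the constant `n`-tuple `m`,
hence on the code of every `n`-tuple bounded by `m`. -/
def HaltsBelow (n : ℕ) (cd : Code) (s m : ℕ) : Prop :=
  ∀ e < tupleCode (fun _ : Fin n => m) + 1, (cd.evaln s e).isSome = true

instance (n : ℕ) (cd : Code) : DecidableRel (HaltsBelow n cd) :=
  fun s m => inferInstanceAs
    (Decidable (∀ e < tupleCode (fun _ : Fin n => m) + 1, (cd.evaln s e).isSome = true))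

/-- The largest `m ≤ s` such that `cd` is seen by stage `s` to halt on all `n`-tuples
bounded by `m`, or `0` if there is none. -/
def haltingBound (n : ℕ) (cd : Code) (s : ℕ) : ℕ :=
  Nat.findGreatest (HaltsBelow n cd s) s

theorem primrecRel_haltsBelow (n : ℕ) (cd : Code) : PrimrecRel (HaltsBelow n cd) := by
  have halts : PrimrecRel fun e s : ℕ => (cd.evaln s e).isSome = true :=
    Primrec.eq.comp (Primrec.option_isSome.comp (Code.primrec_evaln.comp
      (Primrec.pair (Primrec.pair Primrec.snd (Primrec.const cd)) Primrec.fst)))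
      (Primrec.const true)
  have bound : Primrec fun m : ℕ => tupleCode (fun _ : Fin n => m) + 1 :=
    Primrec.succ.comp ((primrec_tupleCode n).comp (Primrec.fin_curry.2 Primrec.fst.to₂))
  exact halts.forall_lt.comp (bound.comp Primrec.snd) Primrec.fst

theorem primrec_haltingBound (n : ℕ) (cd : Code) : Primrec (haltingBound n cd) :=
  Primrec.nat_findGreatest Primrec.id (primrecRel_haltsBelow n cd)

theorem isSome_evaln_mono {cd : Code} {s t e : ℕ} (hst : s ≤ t)
    (h : (cd.evaln s e).isSome = true) : (cd.evaln t e).isSome = true := by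
  obtain ⟨v, hv⟩ := Option.isSome_iff_exists.1 h
  exact Option.isSome_iff_exists.2 ⟨v, Code.evaln_mono hst hv⟩

theorem monotone_haltingBound (n : ℕ) (cd : Code) : Monotone (haltingBound n cd) :=
  fun _ _ hst => Nat.findGreatest_mono (fun _ h e he => isSome_evaln_mono hst (h e he)) hst

theorem exists_stage_forall_lt {cd : Code} (total : ∀ e, (cd.eval e).Dom) (b : ℕ) :
    ∃ s, ∀ e < b, (cd.evaln s e).isSome = true := by
  induction b with
  | zero => exact ⟨0, by simp⟩
  | succ b ih =>
    obtain ⟨s, hs⟩ := ih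
    obtain ⟨t, ht⟩ := Code.evaln_complete.1 (Part.get_mem (total b))
    refine ⟨max s t, fun e he => ?_⟩
    rcases Nat.lt_succ_iff_lt_or_eq.1 he with he | rfl
    · exact isSome_evaln_mono (le_max_left _ _) (hs e he)
    · exact isSome_evaln_mono (le_max_right _ _) (Option.isSome_iff_exists.2 ⟨_, ht⟩)

theorem haltingBound_unbounded (n : ℕ) {cd : Code} (total : ∀ e, (cd.eval e).Dom) (m : ℕ) :
    ∃ s, m ≤ haltingBound n cd s := by
  obtain ⟨s, hs⟩ := exists_stage_forall_lt total (tupleCode (fun _ : Fin n => m) + 1)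
  exact ⟨max s m, Nat.le_findGreatest (le_max_right _ _)
    fun e he => isSome_evaln_mono (le_max_left _ _) (hs e he)⟩

/-- Every computable function on tuples is primitive recursive after composition with a
suitable slow primitive recursive function applied to each coordinate. -/
theorem Computable.exists_primrec_slowdown {n : ℕ} {α : Type*} [Primcodable α]
    {c : (Fin n → ℕ) → α} (hc : Computable c) :
    ∃ p : ℕ → ℕ, Primrec p ∧ Monotone p ∧ (∀ m, ∃ t, m ≤ p t) ∧
      Primrec fun x : Fin n → ℕ => c fun i => p (x i) := by
  have hf : Computable fun e : ℕ =>
      encode ((@decode (Fin n → ℕ) Primcodable.toEncodable e).map c) :=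
    Computable.encode.comp (Computable.option_map Computable.decode (hc.comp Computable.snd).to₂)
  obtain ⟨cd, hcd⟩ := Code.exists_code.1 (Partrec.nat_iff.1 hf)
  have eval_cd (e : ℕ) :
      cd.eval e = Part.some (encode ((@decode (Fin n → ℕ) Primcodable.toEncodable e).map c)) := by
    rw [hcd]; rfl
  have total (e : ℕ) : (cd.eval e).Dom := by rw [eval_cd]; trivial
  refine ⟨haltingBound n cd, primrec_haltingBound n cd, monotone_haltingBound n cd,
    haltingBound_unbounded n total, ?_⟩
  set p := haltingBound n cd
  have hpx : Primrec fun x : Fin n → ℕ => fun i => p (x i) :=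
    Primrec.fin_curry.2 ((primrec_haltingBound n cd).comp
      (Primrec.fin_app.comp Primrec.fst Primrec.snd))
  have hrun : Primrec fun x : Fin n → ℕ => cd.evaln (tupleCode x) (tupleCode fun i => p (x i)) :=
    Code.primrec_evaln.comp (Primrec.pair (Primrec.pair (primrec_tupleCode n) (Primrec.const cd))
      ((primrec_tupleCode n).comp hpx))
  have hdecode : Primrec fun v : ℕ => (decode (α := Option α) v).getD none :=
    Primrec.option_getD.comp Primrec.decode (Primrec.const none)
  refine (Primrec.option_getD.comp
    (Primrec.option_bind hrun (hdecode.comp Primrec.snd).to₂)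
    (Primrec.const (c fun _ => 0))).of_eq fun x => ?_
  have hle (i : Fin n) : p (x i) ≤ p (tupleCode x) :=
    monotone_haltingBound n cd (le_tupleCode x i)
  cases hv : cd.evaln (tupleCode x) (tupleCode fun i => p (x i)) with
  | some v =>
    have := Code.evaln_sound (Option.mem_def.2 hv)
    rw [eval_cd, Part.mem_some_iff] at this
    subst this
    simp [tupleCode]
  | none =>
    have hzero : p (tupleCode x) = 0 := by
      by_contra hne
      have hhalts : HaltsBelow n cd (tupleCode x) (p (tupleCode x)) :=
        Nat.findGreatest_of_ne_zero rfl hne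
      simpa [hv] using hhalts _ (Nat.lt_succ_of_le (monotone_tupleCode n hle))
    have : (fun i => p (x i)) = fun _ => 0 :=
      funext fun i => Nat.le_zero.1 (hzero ▸ hle i)
    simp [this]

theorem UnboundedSet.image {p : ℕ → ℕ} (mono : Monotone p) (unbdd : ∀ m, ∃ t, m ≤ p t)
    {H : Set ℕ} (hH : UnboundedSet H) : UnboundedSet (p '' H) := by
  intro m
  obtain ⟨t, ht⟩ := unbdd m
  obtain ⟨h, hmem, hle⟩ := hH t
  exact ⟨p h, ⟨h, hmem, rfl⟩, ht.trans (mono hle)⟩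

theorem HomogeneousFor.image {n k : ℕ} {c : (Fin n → ℕ) → Fin k} {p : ℕ → ℕ}
    (mono : Monotone p) {H : Set ℕ} (hH : HomogeneousFor (fun x => c fun i => p (x i)) H) :
    HomogeneousFor c (p '' H) := by
  obtain ⟨j, hj⟩ := hH
  refine ⟨j, fun y hy hmem => ?_⟩
  choose x hx hxy using hmem
  obtain rfl : (fun i => p (x i)) = y := funext hxy
  exact hj x (fun a b hab => mono.reflect_lt (hy hab)) hx

theorem stmt5 (n k : ℕ) (hn : 1 ≤ n) (hk : 2 ≤ k)
    (c : (Fin n → ℕ) → Fin k) (hc : Computable c) :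
    ∃ (chat : (Fin n → ℕ) → Fin k) (p : ℕ → ℕ),
      Primrec chat ∧ Primrec p ∧ Monotone p ∧ (∀ m : ℕ, ∃ t, m ≤ p t) ∧
      (∀ x : Fin n → ℕ, Function.Injective (fun i => p (x i)) →
        chat x = c (fun i => p (x i))) ∧
      (∀ H : Set ℕ, UnboundedSet H → HomogeneousFor chat H →
        UnboundedSet (p '' H) ∧ HomogeneousFor c (p '' H)) := by
  obtain ⟨p, hp, mono, unbdd, hchat⟩ := hc.exists_primrec_slowdown
  exact ⟨fun x => c fun i => p (x i), p, hchat, hp, mono, unbdd, fun _ _ => rfl,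
    fun _ hH hhom => ⟨hH.image mono unbdd, hhom.image mono⟩⟩
end

section
/- For every computable ρ : ℕ → List Bool with (ρ n).length = n for all n, there exist a primitive recursive σ : ℕ → List Bool with (σ t).length = t for all t, and a computable nondecreasing unbounded d : ℕ → ℕ with d t ≤ t for all t, such that for every t the string ρ (d t) is a prefix of σ t. -/
open Nat.Partrec (Code)

/-- A computable function on `ℕ` has a program whose time-bounded runs converge to its values. -/
theorem Computable.exists_code_evaln {α : Type*} [Primcodable α] {f : ℕ → α} (hf : Computable f) :
    ∃ c : Code, (∀ k n x, x ∈ Code.evaln k c n → x = Encodable.encode (f n)) ∧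
      ∀ n, ∃ k, Encodable.encode (f n) ∈ Code.evaln k c n := by
  obtain ⟨c, hc⟩ := Code.exists_code.1 hf
  have hmem : ∀ n x, x ∈ Code.eval c n ↔ x = Encodable.encode (f n) := fun n x => by
    simp [hc]
  exact ⟨c, fun k n x hx => (hmem n x).1 (Code.evaln_sound hx),
    fun n => Code.evaln_complete.1 ((hmem n _).2 rfl)⟩

/-- The largest input `n ≤ t` on which `c` halts within `t` steps, or `0` if there is none. -/
def lastHalting (c : Code) (t : ℕ) : ℕ :=
  Nat.findGreatest (fun n => (Code.evaln t c n).isSome = true) t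

theorem lastHalting_le (c : Code) (t : ℕ) : lastHalting c t ≤ t :=
  Nat.findGreatest_le t

theorem monotone_lastHalting (c : Code) : Monotone (lastHalting c) := by
  intro s t hst
  refine Nat.findGreatest_mono (fun n hn => ?_) hst
  obtain ⟨x, hx⟩ := Option.isSome_iff_exists.1 hn
  exact Option.isSome_iff_exists.2 ⟨x, Code.evaln_mono hst hx⟩

theorem le_lastHalting {c : Code} {k n x : ℕ} (h : x ∈ Code.evaln k c n) :
    n ≤ lastHalting c k :=
  Nat.le_findGreatest (Code.evaln_bound h).le (Option.isSome_iff_exists.2 ⟨x, h⟩)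

theorem evaln_lastHalting_isSome {c : Code} {t : ℕ} (h : lastHalting c t ≠ 0) :
    (Code.evaln t c (lastHalting c t)).isSome = true :=
  Nat.findGreatest_of_ne_zero (P := fun n => (Code.evaln t c n).isSome = true) rfl h

theorem primrec_lastHalting (c : Code) : Primrec (lastHalting c) := by
  have hP : PrimrecRel fun t n : ℕ => (Code.evaln t c n).isSome = true :=
    Primrec.primrecPred ((Primrec.option_isSome.comp (Code.primrec_evaln.comp
      (Primrec.pair (Primrec.pair Primrec.fst (Primrec.const c)) Primrec.snd))).of_eq
        fun _ => Bool.decide_coe _ |>.symm)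
  exact Primrec.nat_findGreatest Primrec.id hP

/-- The first `t` entries of `l`, padded with `false`. -/
def padTake (t : ℕ) (l : List Bool) : List Bool :=
  (List.range t).map fun i => l.getD i false

theorem length_padTake (t : ℕ) (l : List Bool) : (padTake t l).length = t := by
  simp [padTake]

theorem prefix_padTake {t : ℕ} {l : List Bool} (h : l.length ≤ t) : l <+: padTake t l := by
  rw [List.prefix_iff_getElem]
  refine ⟨by rwa [length_padTake], fun i hi => ?_⟩
  simp [padTake, hi]

theorem primrec_padTake : Primrec₂ padTake :=
  Primrec.list_map (Primrec.list_range.comp Primrec.fst)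
    ((Primrec.list_getD false).comp (Primrec.snd.comp Primrec.fst) Primrec.snd)

/-- The string output by `c` on `lastHalting c t`, brought to length `t`. -/
def haltingApprox (c : Code) (t : ℕ) : List Bool :=
  padTake t (((Code.evaln t c (lastHalting c t)).bind Encodable.decode).getD [])

theorem primrec_haltingApprox (c : Code) : Primrec (haltingApprox c) := by
  have hrun : Primrec fun t => Code.evaln t c (lastHalting c t) :=
    Code.primrec_evaln.comp
      (Primrec.pair (Primrec.pair Primrec.id (Primrec.const c)) (primrec_lastHalting c))
  exact primrec_padTake.comp Primrec.id
    (Primrec.option_getD.comp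
      (Primrec.option_bind hrun (Primrec.decode.comp Primrec.snd)) (Primrec.const []))

theorem stmt6 (ρ : ℕ → List Bool) (hρ : Computable ρ) (hlen : ∀ n, (ρ n).length = n) :
    ∃ (σ : ℕ → List Bool) (d : ℕ → ℕ),
      Primrec σ ∧ (∀ t, (σ t).length = t) ∧
      Computable d ∧ Monotone d ∧ (∀ m : ℕ, ∃ t, m ≤ d t) ∧ (∀ t, d t ≤ t) ∧
      (∀ t, ρ (d t) <+: σ t) := by
  obtain ⟨c, hsound, hcomplete⟩ := hρ.exists_code_evaln
  refine ⟨haltingApprox c, lastHalting c, primrec_haltingApprox c,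
    fun t => length_padTake t _, (primrec_lastHalting c).to_comp, monotone_lastHalting c,
    fun m => (hcomplete m).imp fun _ => le_lastHalting, lastHalting_le c, fun t => ?_⟩
  by_cases h0 : lastHalting c t = 0
  · rw [h0, List.length_eq_zero_iff.1 (hlen 0)]
    exact List.nil_prefix
  · obtain ⟨x, hx⟩ := Option.isSome_iff_exists.1 (evaln_lastHalting_isSome h0)
    have hout : ((Code.evaln t c (lastHalting c t)).bind Encodable.decode).getD [] =
        ρ (lastHalting c t) := by
      rw [hx, hsound t _ x hx]
      simp
    rw [haltingApprox, hout]
    exact prefix_padTake ((hlen _).trans_le (lastHalting_le c t))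
end

section
/- For every computable I : ℕ → ℚ × ℚ there exists a primitive recursive Î : ℕ → ℚ × ℚ such that the two sequences of rational open intervals cover exactly the same set of reals: ⋃ s, Set.Ioo (((Î s).1 : ℝ)) (((Î s).2 : ℝ)) = ⋃ s, Set.Ioo (((I s).1 : ℝ)) (((I s).2 : ℝ)). -/
/-- The standard encoding of `ℚ` as a `Primcodable` type. -/
instance : Primcodable ℚ := Primcodable.ofEquiv ℕ (Denumerable.eqv ℚ)

/-- A computable sequence can be slowed down to a primitive recursive one that outputs a default
value while waiting for the next term of the original sequence. -/
theorem Computable.exists_primrec_range_subset {α : Type*} [Primcodable α] {f : ℕ → α}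
    (hf : Computable f) (d : α) :
    ∃ g : ℕ → α, Primrec g ∧ Set.range f ⊆ Set.range g ∧ Set.range g ⊆ insert d (Set.range f) := by
  obtain ⟨c, hc⟩ := Nat.Partrec.Code.exists_code.1 hf
  have heval (n : ℕ) : c.eval n = Part.some (Encodable.encode (f n)) := by
    rw [hc]; simp
  refine ⟨fun s => ((Nat.Partrec.Code.evaln s.unpair.1 c s.unpair.2).bind Encodable.decode).getD d,
    ?_, ?_, ?_⟩
  · have hfst : Primrec fun s : ℕ => s.unpair.1 := Primrec.fst.comp Primrec.unpair
    have hsnd : Primrec fun s : ℕ => s.unpair.2 := Primrec.snd.comp Primrec.unpair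
    have hevaln : Primrec fun s : ℕ => Nat.Partrec.Code.evaln s.unpair.1 c s.unpair.2 :=
      Nat.Partrec.Code.primrec_evaln.comp ((hfst.pair (Primrec.const c)).pair hsnd)
    exact Primrec.option_getD.comp
      (Primrec.option_bind hevaln (Primrec.decode.comp Primrec.snd).to₂) (Primrec.const d)
  · rintro _ ⟨n, rfl⟩
    obtain ⟨k, hk⟩ := Nat.Partrec.Code.evaln_complete.1
      (show Encodable.encode (f n) ∈ c.eval n by simp [heval])
    exact ⟨Nat.pair k n, by simp [Option.mem_def.1 hk]⟩
  · rintro _ ⟨s, rfl⟩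
    rcases h : Nat.Partrec.Code.evaln s.unpair.1 c s.unpair.2 with _ | x
    · simp [h]
    · have hx := Nat.Partrec.Code.evaln_sound (Option.mem_def.2 h)
      rw [heval, Part.mem_some_iff] at hx
      simp [h, hx]

theorem stmt7 (I : ℕ → ℚ × ℚ) (hI : Computable I) :
    ∃ Ihat : ℕ → ℚ × ℚ, Primrec Ihat ∧
      (⋃ s : ℕ, Set.Ioo (((Ihat s).1 : ℝ)) (((Ihat s).2 : ℝ))) =
        (⋃ s : ℕ, Set.Ioo (((I s).1 : ℝ)) (((I s).2 : ℝ))) := by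
  obtain ⟨g, hg, hIg, hgI⟩ := hI.exists_primrec_range_subset (0, 0)
  refine ⟨g, hg, Set.Subset.antisymm (Set.iUnion_subset fun s => ?_) (Set.iUnion_subset fun s => ?_)⟩
  · rcases hgI ⟨s, rfl⟩ with h | ⟨t, h⟩
    · simp [h]
    · rw [← h]
      exact Set.subset_iUnion (fun s => Set.Ioo ((I s).1 : ℝ) ((I s).2 : ℝ)) t
  · obtain ⟨t, h⟩ := hIg ⟨s, rfl⟩
    rw [← h]
    exact Set.subset_iUnion (fun s => Set.Ioo ((g s).1 : ℝ) ((g s).2 : ℝ)) t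
end

section
/- There exist primitive recursive relations R_A, R_B : ℕ → ℕ → Bool such that each of (ℕ, R_A) and (ℕ, R_B) is a dense linear order without endpoints, but no primitive recursive bijection h : ℕ → ℕ is an order isomorphism from (ℕ, R_B) onto (ℕ, R_A), i.e., no primitive recursive bijection h satisfies R_B x y = true ↔ R_A (h x) (h y) = true for all x, y. -/
/-- `R : ℕ → ℕ → Bool` defines a dense linear order without endpoints on `ℕ`
(writing `x < y` for `R x y = true`). -/
def IsDLOwithoutEndpoints (R : ℕ → ℕ → Bool) : Prop :=
  (∀ x, R x x = false) ∧
  (∀ x y z, R x y = true → R y z = true → R x z = true) ∧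
  (∀ x y, x ≠ y → R x y = true ∨ R y x = true) ∧
  (∀ x y, R x y = true → ∃ z, R x z = true ∧ R z y = true) ∧
  (∀ x, ∃ z, R z x = true) ∧
  (∀ x, ∃ z, R x z = true)

/-- The order of the dyadic fractions `0.x₀x₁x₂…` attached to natural numbers with binary digits
`x₀, x₁, x₂, …`, least significant digit first. -/
def RevBitLt (x y : ℕ) : Prop :=
  ∃ i, (∀ j < i, x.testBit j = y.testBit j) ∧ x.testBit i = false ∧ y.testBit i = true

namespace RevBitLt

theorem irrefl (x : ℕ) : ¬ RevBitLt x x := by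
  rintro ⟨i, -, h0, h1⟩
  simp [h0] at h1

theorem trans {x y z : ℕ} : RevBitLt x y → RevBitLt y z → RevBitLt x z := by
  rintro ⟨i, hi, hx, hy⟩ ⟨k, hk, hy', hz⟩
  rcases lt_trichotomy i k with h | rfl | h
  · exact ⟨i, fun j hj => (hi j hj).trans (hk j (hj.trans h)), hx, (hk i h).symm.trans hy⟩
  · simp [hy] at hy'
  · exact ⟨k, fun j hj => (hi j (hj.trans h)).trans (hk j hj), (hi k h).trans hy', hz⟩

theorem total {x y : ℕ} (hxy : x ≠ y) : RevBitLt x y ∨ RevBitLt y x := by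
  classical
  have hex : ∃ i, x.testBit i ≠ y.testBit i := by
    by_contra! h
    exact hxy (Nat.eq_of_testBit_eq h)
  have hlt : ∀ j < Nat.find hex, x.testBit j = y.testBit j := fun j hj =>
    not_not.1 (Nat.find_min hex hj)
  have hne := Nat.find_spec hex
  cases hx : x.testBit (Nat.find hex)
  · exact Or.inl ⟨_, hlt, hx, by simpa [hx] using hne.symm⟩
  · exact Or.inr ⟨_, fun j hj => (hlt j hj).symm, by simpa [hx] using hne.symm, hx⟩

theorem self_add_two_pow {x n : ℕ} (h : x < 2 ^ n) : RevBitLt x (x + 2 ^ n) := by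
  refine ⟨n, fun j hj => ?_, Nat.testBit_lt_two_pow h, ?_⟩
  · rw [Nat.add_comm, Nat.testBit_two_pow_add_gt hj]
  · rw [Nat.add_comm, Nat.testBit_two_pow_add_eq, Nat.testBit_lt_two_pow h]
    rfl

theorem exists_between {x y : ℕ} (h : RevBitLt x y) : ∃ n, x < 2 ^ n ∧ RevBitLt (x + 2 ^ n) y := by
  obtain ⟨i, hi, hx, hy⟩ := h
  have key : ∀ j < x + i + 1, (x + 2 ^ (x + i + 1)).testBit j = x.testBit j := fun j hj => by
    rw [Nat.add_comm x, Nat.testBit_two_pow_add_gt hj]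
  refine ⟨x + i + 1, lt_of_lt_of_le Nat.lt_two_pow_self (Nat.pow_le_pow_right two_pos (by omega)),
    i, fun j hj => ?_, ?_, hy⟩
  · rw [key j (by omega), hi j hj]
  · rw [key i (by omega), hx]

theorem two_pow_lt {x n : ℕ} (hx : x ≠ 0) (hn : x ≤ n) : RevBitLt (2 ^ n) x := by
  classical
  have hex : ∃ i, x.testBit i = true := Nat.exists_testBit_of_ne_zero hx
  have hlt : Nat.find hex < n :=
    (Nat.lt_two_pow_self.trans_le (Nat.ge_two_pow_of_testBit (Nat.find_spec hex))).trans_le hn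
  refine ⟨Nat.find hex, fun j hj => ?_, Nat.testBit_two_pow_of_ne hlt.ne', Nat.find_spec hex⟩
  rw [Nat.testBit_two_pow_of_ne (by omega)]
  simpa using (Nat.find_min hex hj)

theorem even_of_lt_one {x : ℕ} (h : RevBitLt x 1) : x % 2 = 0 := by
  obtain ⟨i, -, hx, h1⟩ := h
  obtain rfl : i = 0 := Nat.testBit_one_eq_true_iff_self_eq_zero.1 h1
  simpa [Nat.testBit_zero] using hx

theorem iff_exists_lt {x y : ℕ} : RevBitLt x y ↔
    ∃ i < y, x % 2 ^ i = y % 2 ^ i ∧ x / 2 ^ i % 2 = 0 ∧ y / 2 ^ i % 2 = 1 := by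
  have hmod : ∀ i, x % 2 ^ i = y % 2 ^ i ↔ ∀ j < i, x.testBit j = y.testBit j := fun i => by
    constructor
    · intro h j hj
      simpa [Nat.testBit_mod_two_pow, hj] using congrArg (fun n => n.testBit j) h
    · intro h
      refine Nat.eq_of_testBit_eq fun j => ?_
      by_cases hj : j < i
      · simp [Nat.testBit_mod_two_pow, hj, h j hj]
      · simp [Nat.testBit_mod_two_pow, hj]
  constructor
  · rintro ⟨i, hi, hx, hy⟩
    refine ⟨i, Nat.lt_two_pow_self.trans_le (Nat.ge_two_pow_of_testBit hy), (hmod i).2 hi, ?_, ?_⟩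
    · simpa [Nat.testBit_eq_decide_div_mod_eq] using hx
    · simpa [Nat.testBit_eq_decide_div_mod_eq] using hy
  · rintro ⟨i, -, hi, hx, hy⟩
    exact ⟨i, (hmod i).1 hi, by simp [Nat.testBit_eq_decide_div_mod_eq, hx],
      by simp [Nat.testBit_eq_decide_div_mod_eq, hy]⟩

end RevBitLt

theorem Primrec.nat_pow : Primrec₂ ((· ^ ·) : ℕ → ℕ → ℕ) :=
  Primrec₂.unpaired'.1 Nat.Primrec.pow

theorem PrimrecRel.exists_lt_apply {α : Type*} [Primcodable α] {R : ℕ → α → Prop}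
    (hR : PrimrecRel R) {b : α → ℕ} (hb : Primrec b) : PrimrecPred fun a => ∃ i < b a, R i a :=
  (PrimrecRel.comp hR.exists_mem_list (Primrec.list_range.comp hb) Primrec.id).of_eq (by simp)

theorem primrecRel_revBitLt : PrimrecRel RevBitLt := by
  have hpow : Primrec fun p : ℕ × ℕ × ℕ => 2 ^ p.1 :=
    Primrec.nat_pow.comp (Primrec.const 2) Primrec.fst
  have hx : Primrec fun p : ℕ × ℕ × ℕ => p.2.1 := Primrec.fst.comp Primrec.snd
  have hy : Primrec fun p : ℕ × ℕ × ℕ => p.2.2 := Primrec.snd.comp Primrec.snd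
  have hR : PrimrecRel fun (i : ℕ) (p : ℕ × ℕ) =>
      p.1 % 2 ^ i = p.2 % 2 ^ i ∧ p.1 / 2 ^ i % 2 = 0 ∧ p.2 / 2 ^ i % 2 = 1 := by
    refine PrimrecPred.and (Primrec.eq.comp (Primrec.nat_mod.comp hx hpow)
      (Primrec.nat_mod.comp hy hpow)) (PrimrecPred.and ?_ ?_)
    · exact Primrec.eq.comp (Primrec.nat_mod.comp (Primrec.nat_div.comp hx hpow) (Primrec.const 2))
        (Primrec.const 0)
    · exact Primrec.eq.comp (Primrec.nat_mod.comp (Primrec.nat_div.comp hy hpow) (Primrec.const 2))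
        (Primrec.const 1)
  have hex : PrimrecPred fun p : ℕ × ℕ => ∃ i < p.2,
      p.1 % 2 ^ i = p.2 % 2 ^ i ∧ p.1 / 2 ^ i % 2 = 0 ∧ p.2 / 2 ^ i % 2 = 1 :=
    hR.exists_lt_apply Primrec.snd
  exact hex.of_eq fun p => RevBitLt.iff_exists_lt.symm

open Classical in
/-- The order `RevBitLt` on positive numbers, reindexed by `ℕ`. -/
noncomputable def dyadicLt (x y : ℕ) : Bool := decide (RevBitLt (x + 1) (y + 1))

theorem dyadicLt_iff {x y : ℕ} : dyadicLt x y = true ↔ RevBitLt (x + 1) (y + 1) := by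
  simp [dyadicLt]

theorem primrec₂_dyadicLt : Primrec₂ dyadicLt := by
  classical
  exact (primrecRel_revBitLt.comp (Primrec.succ.comp Primrec.fst)
    (Primrec.succ.comp Primrec.snd)).decide

theorem isDLOwithoutEndpoints_dyadicLt : IsDLOwithoutEndpoints dyadicLt := by
  refine ⟨fun x => ?_, fun x y z => ?_, fun x y hxy => ?_, fun x y => ?_, fun x => ?_, fun x => ?_⟩
  · simpa [dyadicLt] using RevBitLt.irrefl (x + 1)
  · simpa only [dyadicLt_iff] using RevBitLt.trans
  · simpa only [dyadicLt_iff] using RevBitLt.total (by simpa using hxy)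
  · simp only [dyadicLt_iff]
    intro h
    obtain ⟨n, hn, hlt⟩ := h.exists_between
    exact ⟨x + 2 ^ n, by simpa [add_right_comm] using RevBitLt.self_add_two_pow hn,
      by simpa [add_right_comm] using hlt⟩
  · refine ⟨2 ^ (x + 1) - 1, dyadicLt_iff.2 ?_⟩
    rw [Nat.sub_add_cancel Nat.one_le_two_pow]
    exact RevBitLt.two_pow_lt x.succ_ne_zero le_rfl
  · refine ⟨x + 2 ^ (x + 1), dyadicLt_iff.2 ?_⟩
    simpa [add_right_comm] using RevBitLt.self_add_two_pow (x := x + 1) Nat.lt_two_pow_self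

theorem IsDLOwithoutEndpoints.comap {R : ℕ → ℕ → Bool} (hR : IsDLOwithoutEndpoints R) {e : ℕ → ℕ}
    (he : Function.Bijective e) : IsDLOwithoutEndpoints fun x y => R (e x) (e y) := by
  obtain ⟨hirr, htrans, htot, hdense, hleft, hright⟩ := hR
  refine ⟨fun x => hirr _, fun x y z => htrans _ _ _, fun x y hxy => htot _ _ (he.1.ne hxy),
    fun x y h => ?_, fun x => ?_, fun x => ?_⟩
  · obtain ⟨z, hz⟩ := hdense _ _ h
    obtain ⟨w, rfl⟩ := he.2 z
    exact ⟨w, hz⟩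
  · obtain ⟨z, hz⟩ := hleft (e x)
    obtain ⟨w, rfl⟩ := he.2 z
    exact ⟨w, hz⟩
  · obtain ⟨z, hz⟩ := hright (e x)
    obtain ⟨w, rfl⟩ := he.2 z
    exact ⟨w, hz⟩

/-- Some function with primitive recursive graph dominates the diagonal Ackermann function. -/
theorem exists_primrecRel_graph_ack_le :
    ∃ K : ℕ → ℕ, PrimrecRel (fun n k => K n = k) ∧ ∀ n, ack n n ≤ K n := by
  classical
  have hcomp : Computable fun n => ack n n :=
    computable₂_ack.comp Computable.id Computable.id
  obtain ⟨c, hc⟩ := Nat.Partrec.Code.exists_code.1 (Partrec.nat_iff.1 hcomp.partrec)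
  let P : ℕ → ℕ → Prop := fun k n => ∃ v < k + 1, Nat.Partrec.Code.evaln k c n = some v
  have hP : PrimrecRel P := by
    have hR : PrimrecRel fun (v : ℕ) (p : ℕ × ℕ) =>
        Nat.Partrec.Code.evaln p.1 c p.2 = some v := by
      refine Primrec.eq.comp (Nat.Partrec.Code.primrec_evaln.comp
        (g := fun q : ℕ × ℕ × ℕ => ((q.2.1, c), q.2.2)) ?_) (Primrec.option_some.comp Primrec.fst)
      exact ((Primrec.fst.comp Primrec.snd).pair (Primrec.const c)).pair
        (Primrec.snd.comp Primrec.snd)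
    exact hR.exists_lt_apply (Primrec.succ.comp Primrec.fst)
  have hev : ∀ n v k, Nat.Partrec.Code.evaln k c n = some v → v = ack n n := fun n v k h => by
    have := Nat.Partrec.Code.evaln_sound (Option.mem_def.2 h)
    rw [hc] at this
    simpa using this
  have hex : ∀ n, ∃ k, P k n := fun n => by
    have hmem : ack n n ∈ Nat.Partrec.Code.eval c n := by rw [hc]; simp
    obtain ⟨k, hk⟩ := Nat.Partrec.Code.evaln_complete.1 hmem
    exact ⟨max k (ack n n), ack n n, by omega, Nat.Partrec.Code.evaln_mono (le_max_left _ _) hk⟩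
  refine ⟨fun n => Nat.find (hex n), ?_, fun n => ?_⟩
  · have hgraph : PrimrecRel fun n k => P k n ∧ ∀ j < k, ¬ P j n :=
      PrimrecPred.and hP.swap hP.not.forall_lt.swap
    exact hgraph.of_eq fun n k => (Nat.find_eq_iff (hex n)).symm
  · obtain ⟨v, hv, h⟩ := Nat.find_spec (hex n)
    rw [← hev n v _ h]
    exact Nat.le_of_lt_succ hv

theorem PrimrecPred.primrec_nat_count {p : ℕ → Prop} [DecidablePred p] (hp : PrimrecPred p) :
    Primrec (Nat.count p) := by
  refine (Primrec.nat_rec₁ (f := fun n c => c + if p n then 1 else 0) 0 ?_).of_eq fun n => ?_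
  · exact Primrec.nat_add.comp Primrec.snd
      (Primrec.ite (hp.comp Primrec.fst) (Primrec.const 1) (Primrec.const 0))
  · induction n with
    | zero => simp
    | succ n ih => rw [Nat.count_succ, ← ih]

/-- Some primitive recursive permutation of `ℕ` has an inverse growing faster than the Ackermann
function on the odd numbers. -/
theorem exists_primrec_bijective_ack_le :
    ∃ e : ℕ → ℕ, Primrec e ∧ Function.Bijective e ∧ ∀ x n, e x = 2 * n + 1 → ack n n ≤ x := by
  classical
  obtain ⟨K, hK, hack⟩ := exists_primrecRel_graph_ack_le
  let p : ℕ → Prop := fun x => K x.unpair.1 = x.unpair.2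
  have hp : PrimrecPred p :=
    hK.comp (Primrec.fst.comp Primrec.unpair) (Primrec.snd.comp Primrec.unpair)
  have hinf : {x | ¬ p x}.Infinite :=
    Set.infinite_of_injective_forall_mem (f := fun n => Nat.pair n (K n + 1))
      (fun a b h => (Nat.pair_eq_pair.1 h).1) fun n => by simp [p]
  let e : ℕ → ℕ := fun x => if p x then 2 * x.unpair.1 + 1 else 2 * Nat.count (fun y => ¬ p y) x
  refine ⟨e, ?_, ⟨fun x y hxy => ?_, fun n => ?_⟩, fun x n h => ?_⟩
  · exact Primrec.ite hp
      (Primrec.nat_double_succ.comp (Primrec.fst.comp Primrec.unpair))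
      (Primrec.nat_double.comp hp.not.primrec_nat_count)
  · by_cases hx : p x <;> by_cases hy : p y <;> simp only [e, hx, hy, if_true, if_false] at hxy
    · have h1 : x.unpair.1 = y.unpair.1 := by omega
      have h2 : x.unpair.2 = y.unpair.2 := by rw [← hx, ← hy, h1]
      rw [← Nat.pair_unpair x, ← Nat.pair_unpair y, h1, h2]
    · omega
    · omega
    · exact Nat.count_injective (p := fun y => ¬ p y) hx hy (by omega)
  · obtain ⟨k, rfl | rfl⟩ := Nat.even_or_odd' n
    · refine ⟨Nat.nth (fun y => ¬ p y) k, ?_⟩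
      simp only [e, if_neg (Nat.nth_mem_of_infinite hinf k), Nat.count_nth_of_infinite hinf]
    · exact ⟨Nat.pair k (K k), by simp [e, p]⟩
  · by_cases hx : p x <;> simp only [e, hx, if_true, if_false] at h
    · obtain rfl : x.unpair.1 = n := by omega
      exact ((hack _).trans_eq hx).trans (Nat.unpair_right_le x)
    · omega

/-- Among `n + 1` distinct natural numbers one is at least `n`. -/
theorem Function.Injective.exists_le_apply {f : ℕ → ℕ} (hf : Function.Injective f) (n : ℕ) :
    ∃ i ≤ n, n ≤ f i := by
  by_contra! h
  have hcard := Finset.card_le_card_of_injOn (s := Finset.range (n + 1)) (t := Finset.range n) f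
    (fun i hi => by simpa using h i (by simpa [Nat.lt_succ_iff] using hi)) hf.injOn
  simp at hcard

theorem Primrec.sum_range_succ {f : ℕ → ℕ} (hf : Primrec f) :
    Primrec fun n => ∑ i ∈ Finset.range (n + 1), f i := by
  refine (Primrec.nat_rec₁ (f := fun n s => s + f (n + 1)) (f 0) ?_).of_eq fun n => ?_
  · exact Primrec.nat_add.comp Primrec.snd (hf.comp (Primrec.succ.comp Primrec.fst))
  · induction n with
    | zero => simp
    | succ n ih => rw [Finset.sum_range_succ, ← ih]

theorem stmt9 :
    ∃ RA RB : ℕ → ℕ → Bool, Primrec₂ RA ∧ Primrec₂ RB ∧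
      IsDLOwithoutEndpoints RA ∧ IsDLOwithoutEndpoints RB ∧
      ∀ h : ℕ → ℕ, Primrec h → Function.Bijective h →
        ¬ (∀ x y, RB x y = true ↔ RA (h x) (h y) = true) := by
  obtain ⟨e, he, hbij, hack⟩ := exists_primrec_bijective_ack_le
  refine ⟨fun x y => dyadicLt (e x) (e y), dyadicLt,
    primrec₂_dyadicLt.comp (he.comp Primrec.fst) (he.comp Primrec.snd), primrec₂_dyadicLt,
    isDLOwithoutEndpoints_dyadicLt.comap hbij, isDLOwithoutEndpoints_dyadicLt, ?_⟩
  intro h hh hhbij hiso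
  obtain ⟨x₀, hx₀⟩ := (hbij.comp hhbij).2 0
  let z : ℕ → ℕ := fun k => 2 ^ (x₀ + 1 + k) - 1
  have hz : Primrec z :=
    Primrec.nat_sub.comp (Primrec.nat_pow.comp (Primrec.const 2)
      (Primrec.nat_add.comp (Primrec.const (x₀ + 1)) Primrec.id)) (Primrec.const 1)
  have hz_succ : ∀ k, z k + 1 = 2 ^ (x₀ + 1 + k) := fun k => Nat.sub_add_cancel Nat.one_le_two_pow
  have hz_inj : Function.Injective z := fun a b hab => by
    have := congrArg (· + 1) hab
    simp only [hz_succ] at this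
    exact Nat.add_left_cancel (Nat.pow_right_injective le_rfl this)
  have hodd : ∀ k, ∃ n, e (h (z k)) = 2 * n + 1 := fun k => by
    have hlt : dyadicLt (z k) x₀ = true := by
      rw [dyadicLt_iff, hz_succ]
      exact RevBitLt.two_pow_lt x₀.succ_ne_zero (Nat.le_add_right _ _)
    rw [hiso, dyadicLt_iff, show e (h x₀) = 0 from hx₀] at hlt
    have := hlt.even_of_lt_one
    exact ⟨e (h (z k)) / 2, by omega⟩
  choose f hf using hodd
  have hf_inj : Function.Injective f := fun a b hab =>
    hz_inj (hhbij.1 (hbij.1 (by rw [hf, hf, hab])))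
  obtain ⟨m, hm⟩ := exists_lt_ack_of_nat_primrec
    (Primrec.nat_iff.1 (Primrec.sum_range_succ (hh.comp hz)))
  obtain ⟨i, him, hfi⟩ := hf_inj.exists_le_apply m
  refine (hm m).not_ge ?_
  calc ack m m ≤ ack (f i) (f i) := ack_le_ack hfi hfi
    _ ≤ h (z i) := hack _ _ (hf i)
    _ ≤ ∑ j ∈ Finset.range (m + 1), h (z j) :=
      Finset.single_le_sum (f := fun j => h (z j)) (fun _ _ => Nat.zero_le _)
        (Finset.mem_range.2 (Nat.lt_succ_of_le him))
end

section
/- There exist primitive recursive relations E_A, E_B : ℕ → ℕ → Bool, each symmetric and irreflexive, such that each of the graphs (ℕ, E_A) and (ℕ, E_B) satisfies the extension property of the random graph, but no primitive recursive bijection h : ℕ → ℕ is a graph isomorphism from (ℕ, E_B) onto (ℕ, E_A), i.e., no primitive recursive bijection h satisfies E_B x y = true ↔ E_A (h x) (h y) = true for all x, y. -/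
/-- The graph `(ℕ, E)` satisfies the extension property of the random graph:
for every pair of disjoint nonempty finite sets `X, Y ⊆ ℕ` there is a vertex
`z` adjacent to every element of `X` and to no element of `Y`. -/
def RandomGraphExtensionProperty (E : ℕ → ℕ → Bool) : Prop :=
  ∀ X Y : Finset ℕ, X.Nonempty → Y.Nonempty → Disjoint X Y →
    ∃ z : ℕ, (∀ x ∈ X, E z x = true) ∧ (∀ y ∈ Y, E z y = false)

open Nat.Partrec (Code)

theorem primrec₂_testBit : Primrec₂ Nat.testBit := by
  have hpow : Primrec₂ fun m n : ℕ => m ^ n := Primrec₂.unpaired'.1 Nat.Primrec.pow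
  have hbit : PrimrecRel fun k i : ℕ => k / 2 ^ i % 2 = 1 :=
    Primrec.eq.comp
      (Primrec.nat_mod.comp
        (Primrec.nat_div.comp Primrec.fst (hpow.comp (Primrec.const 2) Primrec.snd))
        (Primrec.const 2))
      (Primrec.const 1)
  exact hbit.decide.of_eq fun k i => Nat.testBit_eq_decide_div_mod_eq.symm

/-- The graph of a computable function has a sparse primitive recursive set of codes: each `k` is
the first component of exactly one code, and that code bounds `f k`. -/
theorem Computable.exists_primrecPred_codes {f : ℕ → ℕ} (hf : Computable f) :
    ∃ S : ℕ → Prop, PrimrecPred S ∧ (∀ z, S z → f z.unpair.1 ≤ z) ∧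
      (∀ k, ∃ t, S (Nat.pair k t)) ∧
      ∀ z w, S z → S w → z.unpair.1 = w.unpair.1 → z = w := by
  obtain ⟨c, hc⟩ := Code.exists_code.1 (Partrec.nat_iff.1 hf)
  let R : ℕ → ℕ → Prop := fun t k => Code.evaln t.unpair.1 c k = some t.unpair.2
  have hR : PrimrecRel R := by
    have hfst : Primrec fun p : ℕ × ℕ => p.1.unpair := Primrec.unpair.comp Primrec.fst
    exact Primrec.eq.comp
      (Code.primrec_evaln.comp
        (((Primrec.fst.comp hfst).pair (Primrec.const c)).pair Primrec.snd))
      (Primrec.option_some.comp (Primrec.snd.comp hfst))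
  let M : ℕ → ℕ → Prop := fun t k => R t k ∧ ∀ s < t, ¬ R s k
  have hM : PrimrecRel M := PrimrecPred.and hR hR.not.forall_lt
  refine ⟨fun z => M z.unpair.2 z.unpair.1,
    hM.comp (Primrec.snd.comp Primrec.unpair) (Primrec.fst.comp Primrec.unpair), ?_, ?_, ?_⟩
  · intro z hz
    have hv := Code.evaln_sound (Option.mem_def.2 hz.1)
    rw [hc] at hv
    have hv : z.unpair.2.unpair.2 = f z.unpair.1 := by simpa using hv
    rw [← hv]
    exact (Nat.unpair_right_le _).trans (Nat.unpair_right_le _)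
  · classical
    intro k
    have hk : f k ∈ c.eval k := by rw [hc]; simp
    obtain ⟨s, hs⟩ := Code.evaln_complete.1 hk
    have hex : ∃ t, R t k := ⟨Nat.pair s (f k), by simpa [R] using hs⟩
    refine ⟨Nat.find hex, ?_⟩
    simpa [M] using And.intro (Nat.find_spec hex) fun t ht => Nat.find_min hex ht
  · intro z w hz hw h
    have hsnd : z.unpair.2 = w.unpair.2 := by
      rw [← h] at hw
      rcases lt_trichotomy z.unpair.2 w.unpair.2 with hlt | heq | hgt
      · exact absurd hz.1 (hw.2 _ hlt)
      · exact heq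
      · exact absurd hw.1 (hz.2 _ hgt)
    rw [← Nat.pair_unpair z, ← Nat.pair_unpair w, h, hsnd]

/-- The graph in which the larger endpoint of a pair decides adjacency through `R`. -/
def adjOfLarger (R : ℕ → ℕ → Bool) (x y : ℕ) : Bool :=
  !(x == y) && R (max x y) (min x y)

theorem adjOfLarger_comm (R : ℕ → ℕ → Bool) (x y : ℕ) :
    adjOfLarger R x y = adjOfLarger R y x := by
  simp only [adjOfLarger, max_comm, min_comm, Bool.beq_comm]

theorem adjOfLarger_self (R : ℕ → ℕ → Bool) (x : ℕ) : adjOfLarger R x x = false := by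
  simp [adjOfLarger]

theorem primrec₂_adjOfLarger {R : ℕ → ℕ → Bool} (hR : Primrec₂ R) :
    Primrec₂ (adjOfLarger R) :=
  Primrec.and.comp₂ (Primrec.not.comp₂ Primrec.beq) (hR.comp₂ Primrec.nat_max Primrec.nat_min)

theorem adjOfLarger_of_lt (R : ℕ → ℕ → Bool) {x z : ℕ} (h : x < z) :
    adjOfLarger R z x = R z x := by
  simp [adjOfLarger, h.le, h.ne']

theorem randomGraphExtensionProperty_adjOfLarger {R : ℕ → ℕ → Bool}
    (hR : ∀ k, ∃ z, k ≤ z ∧ ∀ i, R z i = k.testBit i) :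
    RandomGraphExtensionProperty (adjOfLarger R) := by
  intro X Y _ _ hXY
  let N := (X ∪ Y).sup id + 1
  have hN : ∀ x ∈ X ∪ Y, x < N := fun x hx => Nat.lt_succ_of_le (Finset.le_sup (f := id) hx)
  let k := ∑ i ∈ insert N X, 2 ^ i
  have hbit : ∀ i, k.testBit i = true ↔ i ∈ insert N X := fun i => by
    rw [← Nat.mem_bitIndices, ← List.mem_toFinset, Finset.toFinset_bitIndices_sum_two_pow]
  have hNk : N < k := N.lt_two_pow_self.trans_le
    (Finset.single_le_sum (f := fun i => 2 ^ i) (fun _ _ => Nat.zero_le _)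
      (Finset.mem_insert_self N X))
  obtain ⟨z, hkz, hz⟩ := hR k
  refine ⟨z, fun x hx => ?_, fun y hy => ?_⟩
  · have := hN x (Finset.mem_union_left _ hx)
    rw [adjOfLarger_of_lt R (by omega), hz, hbit]
    exact Finset.mem_insert_of_mem hx
  · have := hN y (Finset.mem_union_right _ hy)
    rw [adjOfLarger_of_lt R (by omega), hz, ← Bool.not_eq_true, hbit, Finset.mem_insert]
    rintro (h | h)
    · omega
    · exact Finset.disjoint_left.1 hXY h hy

theorem stmt10 :
    ∃ EA EB : ℕ → ℕ → Bool, Primrec₂ EA ∧ Primrec₂ EB ∧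
      (∀ x y, EA x y = EA y x) ∧ (∀ x, EA x x = false) ∧
      (∀ x y, EB x y = EB y x) ∧ (∀ x, EB x x = false) ∧
      RandomGraphExtensionProperty EA ∧ RandomGraphExtensionProperty EB ∧
      ∀ h : ℕ → ℕ, Primrec h → Function.Bijective h →
        ¬ (∀ x y, EB x y = true ↔ EA (h x) (h y) = true) := by
  classical
  have hack : Computable fun k => ack k (k + 1) :=
    computable₂_ack.comp Computable.id Computable.succ
  obtain ⟨S, hS, hSle, hSex, hSinj⟩ := hack.exists_primrecPred_codes
  -- In `EA` only the sparse vertices in `S` see smaller ones; in `EB` the even vertices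
  -- form a clique.
  let RA : ℕ → ℕ → Bool := fun z i => decide (S z) && z.unpair.1.testBit i
  let RB : ℕ → ℕ → Bool := fun z i => decide (z % 2 = 0) || (z / 2).testBit i
  have hRA : Primrec₂ RA := Primrec.and.comp (hS.decide.comp Primrec.fst)
    (primrec₂_testBit.comp (Primrec.fst.comp (Primrec.unpair.comp Primrec.fst)) Primrec.snd)
  have hEven : PrimrecPred fun z : ℕ => z % 2 = 0 :=
    Primrec.eq.comp (Primrec.nat_mod.comp Primrec.id (Primrec.const 2)) (Primrec.const 0)
  have hRB : Primrec₂ RB := Primrec.or.comp (hEven.decide.comp Primrec.fst)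
    (primrec₂_testBit.comp (Primrec.nat_div.comp Primrec.fst (Primrec.const 2)) Primrec.snd)
  refine ⟨adjOfLarger RA, adjOfLarger RB, primrec₂_adjOfLarger hRA, primrec₂_adjOfLarger hRB,
    adjOfLarger_comm RA, adjOfLarger_self RA, adjOfLarger_comm RB, adjOfLarger_self RB,
    randomGraphExtensionProperty_adjOfLarger fun k => ?_,
    randomGraphExtensionProperty_adjOfLarger fun k => ⟨2 * k + 1, by omega, fun i => ?_⟩, ?_⟩
  · obtain ⟨t, ht⟩ := hSex k
    exact ⟨Nat.pair k t, Nat.left_le_pair k t, fun i => by simp [RA, ht]⟩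
  · have hhalf : (2 * k + 1) / 2 = k := by omega
    simp [RB, hhalf]
  · intro h hprim hbij hiso
    have hdouble : Primrec fun i : ℕ => h (2 * i) :=
      hprim.comp (Primrec.nat_mul.comp (Primrec.const 2) Primrec.id)
    obtain ⟨m, hm⟩ := exists_lt_ack_of_nat_primrec (Primrec.nat_iff.1 hdouble)
    have hclique : ∀ i j, i ≠ j → S (h (2 * i)) ∨ S (h (2 * j)) := by
      intro i j hij
      have hB : adjOfLarger RB (2 * i) (2 * j) = true := by
        rcases max_choice (2 * i) (2 * j) with hmax | hmax <;> simp [adjOfLarger, RB, hmax, hij]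
      have hA := (hiso _ _).1 hB
      rcases max_choice (h (2 * i)) (h (2 * j)) with hmax | hmax <;>
        simp only [adjOfLarger, RA, hmax, Bool.and_eq_true, decide_eq_true_eq] at hA
      · exact Or.inl hA.2.1
      · exact Or.inr hA.2.1
    let label : ℕ → ℕ := fun i =>
      if S (h (2 * i)) then (h (2 * i)).unpair.1 + 1 else 0
    have hlabel : Function.Injective label := by
      intro i j hij
      by_contra hne
      have hor := hclique i j hne
      by_cases hi : S (h (2 * i)) <;> by_cases hj : S (h (2 * j)) <;>
        simp only [label, hi, hj, if_true, if_false] at hij hor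
      · have := hbij.1 (hSinj _ _ hi hj (by omega))
        omega
      all_goals simp at hij hor
    obtain ⟨i, hi, hlarge⟩ : ∃ i < m + 2, m + 1 ≤ label i := by
      by_contra! hsmall
      have := Finset.card_le_card_of_injOn (s := Finset.range (m + 2))
        (t := Finset.range (m + 1)) label
        (fun i hi => by simpa using hsmall i (by simpa using hi)) hlabel.injOn
      simp at this
    by_cases hSi : S (h (2 * i))
    · simp only [label, hSi, if_true] at hlarge
      have hle := hSle _ hSi
      have hmono : ack m i ≤ ack (h (2 * i)).unpair.1 ((h (2 * i)).unpair.1 + 1) :=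
        ack_le_ack (by omega) (by omega)
      have := hm i
      omega
    · simp [label, hSi] at hlarge
end

section
/- Let p be a prime. Suppose ℕ carries an AddCommGroup structure and a Module (ZMod p) structure such that addition (fun x y => x + y : ℕ → ℕ → ℕ) is primitive recursive and scalar multiplication (fun c x => c • x : ZMod p → ℕ → ℕ) is primitive recursive. Then there exists a primitive recursive injective function b : ℕ → ℕ whose values form a basis of the module: the family (fun i => b i) is linearly independent over ZMod p and Submodule.span (ZMod p) (Set.range b) = ⊤. -/
/-- The canonical equivalence between `ZMod n` and `Fin n` for `n ≠ 0`,
given by `ZMod.val`. -/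
def zmodEquivFin (n : ℕ) [NeZero n] : ZMod n ≃ Fin n where
  toFun a := ⟨a.val, ZMod.val_lt a⟩
  invFun i := ((i : ℕ) : ZMod n)
  left_inv a := ZMod.natCast_rightInverse a
  right_inv i := by
    apply Fin.ext
    simpa using ZMod.val_cast_of_lt i.isLt

/-- The standard encoding of `ZMod n` as a `Primcodable` type. -/
instance (n : ℕ) [NeZero n] : Primcodable (ZMod n) :=
  Primcodable.ofEquiv (Fin n) (zmodEquivFin n)

open Encodable Denumerable

section GreedyBasis

variable {V : Type*} [Denumerable V] [DecidableEq V]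

/-- The element of `V` of least code that does not occur in the list `l`. -/
def leastNotMem (l : List V) : V :=
  ofNat V ((List.range (l.length + 1)).findIdx fun k => !decide (ofNat V k ∈ l))

theorem exists_le_length_ofNat_notMem (l : List V) : ∃ k ≤ l.length, ofNat V k ∉ l := by
  by_contra! h
  have hsub : (List.range (l.length + 1)).map (ofNat V) ⊆ l := by
    intro x hx
    obtain ⟨k, hk, rfl⟩ := List.mem_map.1 hx
    exact h k (Nat.lt_succ_iff.1 (List.mem_range.1 hk))
  have hnodup : ((List.range (l.length + 1)).map (ofNat V)).Nodup :=
    List.nodup_range.map (Denumerable.eqv V).symm.injective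
  have := (hnodup.subperm hsub).length_le
  simp at this

theorem leastNotMem_findIdx_lt (l : List V) :
    ((List.range (l.length + 1)).findIdx fun k => !decide (ofNat V k ∈ l)) <
      (List.range (l.length + 1)).length := by
  obtain ⟨k, hk, hkl⟩ := exists_le_length_ofNat_notMem l
  exact List.findIdx_lt_length_of_exists
    ⟨k, by simpa [Nat.lt_succ_iff] using hk, by simpa using hkl⟩

theorem leastNotMem_notMem (l : List V) : leastNotMem l ∉ l := by
  have h := List.findIdx_getElem (w := leastNotMem_findIdx_lt l)
  simpa [leastNotMem] using h

theorem encode_leastNotMem_le {l : List V} {x : V} (hx : x ∉ l) :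
    encode (leastNotMem l) ≤ encode x := by
  by_contra! h
  rw [leastNotMem, encode_ofNat] at h
  have := List.not_of_lt_findIdx h
  simp [hx] at this

theorem primrec_leastNotMem : Primrec (leastNotMem : List V → V) := by
  have hmem : PrimrecRel fun (l : List V) (k : ℕ) => ofNat V k ∈ l :=
    ((Primrec.eq (α := V)).exists_mem_list.comp Primrec.fst
      ((Primrec.ofNat V).comp Primrec.snd)).of_eq fun a => by simp
  exact (Primrec.ofNat V).comp (Primrec.list_findIdx
    (Primrec.list_range.comp (Primrec.succ.comp Primrec.list_length))
    (Primrec.not.comp hmem.decide).to₂)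

variable (K : Type*) [Field K] [Fintype K] [AddCommGroup V] [Module K V]

/-- Extend a list enumerating a subspace by the least vector missing from it: the result
enumerates the subspace generated by both. -/
noncomputable def extendSpan (l : List V) : List V :=
  (Finset.univ : Finset K).toList.flatMap fun c => l.map fun x => c • leastNotMem l + x

/-- A list enumerating the span of the first `n` vectors of the greedy basis. -/
noncomputable def greedySpan (n : ℕ) : List V :=
  (extendSpan K)^[n] [0]

/-- The greedy basis: each vector is the one of least code outside the span of its
predecessors. -/
noncomputable def greedyBasis (n : ℕ) : V :=
  leastNotMem (greedySpan K n)

theorem mem_greedySpan (n : ℕ) (x : V) :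
    x ∈ greedySpan K n ↔ x ∈ Submodule.span K (greedyBasis K '' Set.Iio n : Set V) := by
  induction n generalizing x with
  | zero => simp [greedySpan]
  | succ n ih =>
    have hIio : Set.Iio (n + 1) = insert n (Set.Iio n) := by
      ext; simp
    rw [hIio, Set.image_insert_eq, Submodule.mem_span_insert, greedySpan,
      Function.iterate_succ_apply', ← greedySpan]
    simp only [extendSpan, greedyBasis, List.mem_flatMap, Finset.mem_toList, Finset.mem_univ,
      true_and, List.mem_map, ih, eq_comm]

theorem greedyBasis_notMem_span (n : ℕ) :
    (greedyBasis K n : V) ∉ Submodule.span K (greedyBasis K '' Set.Iio n) := by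
  rw [← mem_greedySpan]
  exact leastNotMem_notMem _

theorem linearIndependent_of_notMem_span_image_Iio {K V : Type*} [DivisionRing K]
    [AddCommGroup V] [Module K V] {b : ℕ → V}
    (hb : ∀ n, b n ∉ Submodule.span K (b '' Set.Iio n)) : LinearIndependent K b := by
  have hIio (n : ℕ) : LinearIndepOn K b (Set.Iio n) := by
    induction n with
    | zero => simp
    | succ n ih =>
      have hins : Set.Iio (n + 1) = insert n (Set.Iio n) := by
        ext; simp
      rw [hins]
      exact ih.insert (hb n)
  rw [← linearIndepOn_univ_iff, ← Set.iUnion_Iio (α := ℕ)]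
  exact linearIndepOn_iUnion_of_directed (monotone_Iio (α := ℕ)).directed_le hIio

theorem linearIndependent_greedyBasis : LinearIndependent K (greedyBasis K : ℕ → V) :=
  linearIndependent_of_notMem_span_image_Iio (greedyBasis_notMem_span K)

theorem span_range_greedyBasis :
    Submodule.span K (Set.range (greedyBasis K : ℕ → V)) = ⊤ := by
  rw [eq_top_iff]
  rintro x -
  by_contra hx
  have hle (n : ℕ) : encode (greedyBasis K n : V) ≤ encode x := by
    refine encode_leastNotMem_le fun h => hx ?_
    exact Submodule.span_mono (Set.image_subset_range _ _) ((mem_greedySpan K n x).1 h)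
  have hinj : Function.Injective fun n => encode (greedyBasis K n : V) :=
    encode_injective.comp (linearIndependent_greedyBasis K).injective
  exact Set.infinite_range_of_injective hinj
    ((Set.finite_Iic (encode x)).subset (Set.range_subset_iff.2 hle))

theorem primrec_greedyBasis [Primcodable K] (hadd : Primrec₂ fun x y : V => x + y)
    (hsmul : Primrec₂ fun (c : K) (x : V) => c • x) :
    Primrec (greedyBasis K : ℕ → V) := by
  have hterm : Primrec₂ fun (q : List V × K) (x : V) => q.2 • leastNotMem q.1 + x :=
    hadd.comp (hsmul.comp (Primrec.snd.comp Primrec.fst)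
      (primrec_leastNotMem.comp (Primrec.fst.comp Primrec.fst))) Primrec.snd
  have hext : Primrec (extendSpan K : List V → List V) :=
    Primrec.list_flatMap (Primrec.const _) (Primrec.list_map Primrec.fst hterm).to₂
  exact primrec_leastNotMem.comp
    (Primrec.nat_iterate Primrec.id (Primrec.const _) (hext.comp Primrec.snd).to₂)

theorem exists_primrec_basis [Primcodable K] (hadd : Primrec₂ fun x y : V => x + y)
    (hsmul : Primrec₂ fun (c : K) (x : V) => c • x) :
    ∃ b : ℕ → V, Primrec b ∧ Function.Injective b ∧ LinearIndependent K b ∧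
      Submodule.span K (Set.range b) = ⊤ :=
  ⟨greedyBasis K, primrec_greedyBasis K hadd hsmul, (linearIndependent_greedyBasis K).injective,
    linearIndependent_greedyBasis K, span_range_greedyBasis K⟩

end GreedyBasis

/-- If `ℕ` carries an `AddCommGroup` structure `G` and a `Module (ZMod p)`
structure `M` (over a prime `p`) whose addition and scalar multiplication are
primitive recursive, then the resulting `ZMod p`-vector space has a primitive
recursive (injective) basis. -/
theorem stmt11 (p : ℕ) [NeZero p] (hp : p.Prime)
    (G : AddCommGroup ℕ) (M : @Module (ZMod p) ℕ _ G.toAddCommMonoid)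
    (hadd : Primrec₂ fun x y : ℕ => G.toAdd.add x y)
    (hsmul : Primrec₂ fun (c : ZMod p) (x : ℕ) => M.toSMul.smul c x) :
    ∃ b : ℕ → ℕ, Primrec b ∧ Function.Injective b ∧
      @LinearIndependent ℕ (ZMod p) ℕ b _ G.toAddCommMonoid M ∧
      @Submodule.span (ZMod p) ℕ _ G.toAddCommMonoid M (Set.range b) = ⊤ := by
  have : Fact p.Prime := ⟨hp⟩
  exact @exists_primrec_basis ℕ _ _ (ZMod p) _ _ G M _ hadd hsmul
end

section
/- There exists a primitive recursive T : List ℕ → Bool which is a nonempty pruned tree (T [] = true, T is downward closed under prefixes, and every σ with T σ = true has an extension σ ++ [m] with T (σ ++ [m]) = true) such that no primitive recursive f : ℕ → ℕ is a path through T: for every primitive recursive f there is an n with T ([f 0, …, f (n−1)]) = false. -/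
open Nat.Partrec (Code)

/-- The tree of those `σ` whose `i`-th entry bounds the running time of `c` on input `i`. -/
def haltingTree (c : Code) (σ : List ℕ) : Bool :=
  decide (∀ i ∈ List.range σ.length, (Code.evaln (σ.getD i 0) c i).isSome = true)

theorem haltingTree_eq_true {c : Code} {σ : List ℕ} :
    haltingTree c σ = true ↔ ∀ i < σ.length, (Code.evaln (σ.getD i 0) c i).isSome = true := by
  simp [haltingTree]

theorem primrec_haltingTree (c : Code) : Primrec (haltingTree c) := by
  have hR : PrimrecRel fun (i : ℕ) (σ : List ℕ) =>
      (Code.evaln (σ.getD i 0) c i).isSome = true := by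
    have h : Primrec fun p : ℕ × List ℕ => Code.evaln (p.2.getD p.1 0) c p.1 :=
      Code.primrec_evaln.comp
        ((((Primrec.list_getD 0).comp Primrec.snd Primrec.fst).pair (Primrec.const c)).pair
          Primrec.fst)
    exact Primrec.eq.comp (Primrec.option_isSome.comp h) (Primrec.const true)
  exact (hR.forall_mem_list.comp (Primrec.list_range.comp Primrec.list_length) Primrec.id).decide

theorem haltingTree_of_prefix {c : Code} {σ τ : List ℕ} (h : σ <+: τ)
    (hτ : haltingTree c τ = true) : haltingTree c σ = true := by
  obtain ⟨ρ, rfl⟩ := h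
  rw [haltingTree_eq_true] at *
  intro i hi
  have := hτ i (by simp; omega)
  rwa [List.getD_append _ _ _ _ hi] at this

theorem exists_haltingTree_append {c : Code} (hc : ∀ n, (c.eval n).Dom) {σ : List ℕ}
    (hσ : haltingTree c σ = true) : ∃ m, haltingTree c (σ ++ [m]) = true := by
  obtain ⟨m, hm⟩ := Code.evaln_complete.1 (Part.get_mem (hc σ.length))
  refine ⟨m, haltingTree_eq_true.2 fun i hi => ?_⟩
  rcases Nat.lt_succ_iff_lt_or_eq.1 (by simpa using hi) with hi | rfl
  · rw [List.getD_append _ _ _ _ hi]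
    exact haltingTree_eq_true.1 hσ i hi
  · simpa using Option.isSome_of_mem hm

/-- A primitive recursive path through the halting tree of `c` makes the function computed by `c`
primitive recursive. -/
theorem primrec_of_path_haltingTree {c : Code} {g f : ℕ → ℕ} (hc : c.eval = fun n => Part.some (g n))
    (hf : Primrec f) (hpath : ∀ n, haltingTree c (List.ofFn fun i : Fin n => f i) = true) :
    Primrec g := by
  have h : Primrec fun n => (Code.evaln (f n) c n).getD 0 :=
    Primrec.option_getD.comp
      (Code.primrec_evaln.comp ((hf.pair (Primrec.const c)).pair Primrec.id)) (Primrec.const 0)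
  refine h.of_eq fun n => ?_
  have hn := haltingTree_eq_true.1 (hpath (n + 1)) n (by simp)
  obtain ⟨x, hx⟩ := Option.isSome_iff_exists.1 hn
  rw [List.getD_eq_getElem _ _ (by simp), List.getElem_ofFn] at hx
  have hxg : x ∈ c.eval n := Code.evaln_sound hx
  rw [hc, Part.mem_some_iff] at hxg
  simp [hx, hxg]

theorem stmt13 :
    ∃ T : List ℕ → Bool, Primrec T ∧ T [] = true ∧
      (∀ σ τ : List ℕ, σ <+: τ → T τ = true → T σ = true) ∧
      (∀ σ : List ℕ, T σ = true → ∃ m : ℕ, T (σ ++ [m]) = true) ∧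
      (∀ f : ℕ → ℕ, Primrec f →
        ∃ n : ℕ, T (List.ofFn fun i : Fin n => f i) = false) := by
  have hack : Computable fun n => ack n n := computable₂_ack.comp Computable.id Computable.id
  obtain ⟨c, hc⟩ := Code.exists_code.1 (Partrec.nat_iff.1 hack)
  have hc' : c.eval = fun n => Part.some (ack n n) := hc
  refine ⟨haltingTree c, primrec_haltingTree c, by simp [haltingTree],
    fun _ _ => haltingTree_of_prefix,
    fun _ => exists_haltingTree_append fun n => by rw [hc']; trivial, fun f hf => ?_⟩
  by_contra! hpath
  exact not_primrec_ack_self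
    (primrec_of_path_haltingTree hc' hf fun n => by simpa using hpath n)
end

section
/- Szpilrajn's theorem holds primitively recursively: if R : ℕ → ℕ → Bool is primitive recursive and the relation x ≤ y ↔ R x y = true is a partial order on ℕ (reflexive, antisymmetric, transitive), then there exists a primitive recursive L : ℕ → ℕ → Bool such that x ≼ y ↔ L x y = true is a linear order on ℕ (reflexive, antisymmetric, transitive, total) extending R: R x y = true → L x y = true for all x, y. -/
/-- The lower sets `{k | R k x}` and `{k | R k y}` first differ at some `k ≤ x + y`, and this `k`
lies in the second one. -/
def LowerSetLexLT (R : ℕ → ℕ → Bool) (x y : ℕ) : Prop :=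
  ∃ k ∈ List.range (x + y + 1),
    (∀ j ∈ List.range k, R j x = R j y) ∧ R k x = false ∧ R k y = true

theorem primrecRel_lowerSetLexLT {R : ℕ → ℕ → Bool} (hR : Primrec₂ R) :
    PrimrecRel (LowerSetLexLT R) := by
  have hagree : PrimrecRel fun (j : ℕ) (p : ℕ × ℕ) => R j p.1 = R j p.2 :=
    Primrec.eq.comp (hR.comp Primrec.fst (Primrec.fst.comp Primrec.snd))
      (hR.comp Primrec.fst (Primrec.snd.comp Primrec.snd))
  have hbody : PrimrecRel fun (k : ℕ) (p : ℕ × ℕ) =>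
      (∀ j ∈ List.range k, R j p.1 = R j p.2) ∧ R k p.1 = false ∧ R k p.2 = true :=
    (hagree.forall_mem_list.comp (Primrec.list_range.comp Primrec.fst) Primrec.snd).and
      ((Primrec.eq.comp (hR.comp Primrec.fst (Primrec.fst.comp Primrec.snd))
        (Primrec.const false)).and
        (Primrec.eq.comp (hR.comp Primrec.fst (Primrec.snd.comp Primrec.snd))
        (Primrec.const true)))
  exact hbody.exists_mem_list.comp
    (Primrec.list_range.comp (Primrec.succ.comp (Primrec.nat_add.comp Primrec.fst Primrec.snd)))
    Primrec.id

section

variable {R : ℕ → ℕ → Bool}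

theorem eq_of_forall_le_add_eq (hrefl : ∀ x, R x x = true)
    (hantisymm : ∀ x y, R x y = true → R y x = true → x = y) {x y : ℕ}
    (h : ∀ k ≤ x + y, R k x = R k y) : x = y :=
  hantisymm x y ((h x (by lia)).symm.trans (hrefl x)) ((h y (by lia)).trans (hrefl y))

theorem lowerSetLexLT_iff (hrefl : ∀ x, R x x = true)
    (hantisymm : ∀ x y, R x y = true → R y x = true → x = y) (x y : ℕ) :
    LowerSetLexLT R x y ↔ toLex (fun k => R k x) < toLex (fun k => R k y) := by
  constructor
  · rintro ⟨k, -, hk, hx, hy⟩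
    exact ⟨k, fun j hj => hk j (List.mem_range.2 hj), Bool.lt_iff.2 ⟨hx, hy⟩⟩
  · rintro ⟨k, hk, hlt⟩
    obtain ⟨hx, hy⟩ := Bool.lt_iff.1 hlt
    refine ⟨k, List.mem_range.2 ?_, fun j hj => hk j (List.mem_range.1 hj), hx, hy⟩
    by_contra hle
    obtain rfl : x = y :=
      eq_of_forall_le_add_eq hrefl hantisymm fun j hj => hk j (by lia)
    exact lt_irrefl _ hlt

end

theorem stmt14 (R : ℕ → ℕ → Bool) (hR : Primrec₂ R)
    (hrefl : ∀ x, R x x = true)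
    (hantisymm : ∀ x y, R x y = true → R y x = true → x = y)
    (htrans : ∀ x y z, R x y = true → R y z = true → R x z = true) :
    ∃ L : ℕ → ℕ → Bool, Primrec₂ L ∧
      (∀ x, L x x = true) ∧
      (∀ x y, L x y = true → L y x = true → x = y) ∧
      (∀ x y z, L x y = true → L y z = true → L x z = true) ∧
      (∀ x y, L x y = true ∨ L y x = true) ∧
      (∀ x y, R x y = true → L x y = true) := by
  classical
  let f : ℕ → Lex (ℕ → Bool) := fun x => toLex fun k => R k x
  have hL : ∀ x y, decide (¬ LowerSetLexLT R y x) = true ↔ f x ≤ f y := fun x y => by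
    rw [decide_eq_true_iff, lowerSetLexLT_iff hrefl hantisymm]
    exact not_lt (a := f y) (b := f x)
  refine ⟨fun x y => decide (¬ LowerSetLexLT R y x),
    ((primrecRel_lowerSetLexLT hR).comp Primrec.snd Primrec.fst).not.decide, ?_⟩
  simp only [hL]
  refine ⟨fun x => le_rfl, fun x y hxy hyx => ?_, fun x y z => le_trans,
    fun x y => le_total _ _, fun x y hxy => ?_⟩
  · exact eq_of_forall_le_add_eq hrefl hantisymm fun k _ =>
      congrFun (toLex.injective (le_antisymm hxy hyx)) k
  · exact Pi.toLex_monotone fun k => Bool.le_iff_imp.2 fun hk => htrans k x y hk hxy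
end

section
/- Every primitive recursive pseudo-transitive oriented graph has a primitive recursive transitive reorientation: if D : ℕ → ℕ → Bool is primitive recursive with D x x = false for all x, ¬(D x y = true ∧ D y x = true) for all x, y, and whenever D a b = true and D b c = true one has D a c = true or D c a = true, then there exists a primitive recursive R : ℕ → ℕ → Bool such that ¬(R x y = true ∧ R y x = true), R is transitive (R a b = true → R b c = true → R a c = true), R is a reorientation of D (D x y = true → R x y = true ∨ R y x = true, and R x y = true → D x y = true ∨ D y x = true), for all vertices. -/
namespace Reorientation

/-- The position of `x` relative to the pivot `z`: `0` below, `2` above, `1` not adjacent. -/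
def side (D : ℕ → ℕ → Bool) (z x : ℕ) : ℕ :=
  bif D x z then 0 else bif D z x then 2 else 1

/-- Quicksort addresses in base three. At step `z`, the vertex `z` is the pivot of its own cell
(the vertices sharing its address), and the vertices of that cell are split according to their
side of `z`. -/
def address (D : ℕ → ℕ → Bool) : ℕ → ℕ → ℕ
  | 0, _ => 0
  | z + 1, x =>
    3 * address D z x + if address D z z = address D z x then side D z x else 1

/-- The quicksort reorientation: an edge points from the smaller to the larger address. -/
def reorient (D : ℕ → ℕ → Bool) (x y : ℕ) : Bool :=
  (D x y || D y x) && decide (address D (x + y + 1) x < address D (x + y + 1) y)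

/-! ### Primitive recursiveness -/

/-- The address of `x` computed from the list `l` of addresses of the pivots. -/
def addressFrom (D : ℕ → ℕ → Bool) (l : List ℕ) (x n : ℕ) : ℕ :=
  n.rec (motive := fun _ => ℕ) 0
    fun i acc => 3 * acc + if l.getD i 0 = acc then side D i x else 1

theorem addressFrom_eq (D : ℕ → ℕ → Bool) (m x n : ℕ) (h : n ≤ m) :
    addressFrom D ((List.range m).map fun i => address D i i) x n = address D n x := by
  induction n with
  | zero => rfl
  | succ n ih =>
    have ih := ih (by lia)
    unfold addressFrom at ih ⊢
    have hn : n < m := h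
    simp only [ih, address]
    simp [List.getD_eq_getElem?_getD, hn]

theorem primrec_side {D : ℕ → ℕ → Bool} (hD : Primrec₂ D) : Primrec₂ (side D) :=
  Primrec.cond (hD.comp Primrec.snd Primrec.fst) (Primrec.const 0)
    (Primrec.cond (hD.comp Primrec.fst Primrec.snd) (Primrec.const 2) (Primrec.const 1))

theorem primrec_addressFrom {D : ℕ → ℕ → Bool} (hD : Primrec₂ D) :
    Primrec₂ fun (p : List ℕ × ℕ) (n : ℕ) => addressFrom D p.1 p.2 n := by
  refine Primrec.nat_rec (f := fun _ => 0)
    (g := fun (p : List ℕ × ℕ) (q : ℕ × ℕ) =>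
      3 * q.2 + if p.1.getD q.1 0 = q.2 then side D q.1 p.2 else 1) (Primrec.const 0) ?_
  have hi : Primrec fun r : (List ℕ × ℕ) × (ℕ × ℕ) => r.2.1 := Primrec.fst.comp Primrec.snd
  have hacc : Primrec fun r : (List ℕ × ℕ) × (ℕ × ℕ) => r.2.2 := Primrec.snd.comp Primrec.snd
  have hl : Primrec fun r : (List ℕ × ℕ) × (ℕ × ℕ) => r.1.1 := Primrec.fst.comp Primrec.fst
  have hx : Primrec fun r : (List ℕ × ℕ) × (ℕ × ℕ) => r.1.2 := Primrec.snd.comp Primrec.fst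
  exact Primrec.nat_add.comp (Primrec.nat_mul.comp (Primrec.const 3) hacc)
    (Primrec.ite (Primrec.eq.comp ((Primrec.list_getD 0).comp hl hi) hacc)
      ((primrec_side hD).comp hi hx) (Primrec.const 1))

theorem primrec_address_self {D : ℕ → ℕ → Bool} (hD : Primrec₂ D) :
    Primrec fun n => address D n n := by
  have h : Primrec₂ fun (_ : Unit) (n : ℕ) => address D n n := by
    refine Primrec.nat_strong_rec _
      (g := fun _ l => some (addressFrom D l l.length l.length)) ?_ ?_
    · have hlen : Primrec fun p : Unit × List ℕ => p.2.length :=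
        Primrec.list_length.comp Primrec.snd
      exact Primrec.option_some.comp
        ((primrec_addressFrom hD).comp (Primrec.snd.pair hlen) hlen)
    · intro _ n
      simp [addressFrom_eq]
  exact h.comp (Primrec.const ()) Primrec.id

theorem primrec_address {D : ℕ → ℕ → Bool} (hD : Primrec₂ D) : Primrec₂ (address D) := by
  have hl : Primrec fun p : ℕ × ℕ => (List.range p.1).map fun i => address D i i :=
    Primrec.list_map (Primrec.list_range.comp Primrec.fst)
      ((primrec_address_self hD).comp Primrec.snd)
  exact ((primrec_addressFrom hD).comp (hl.pair Primrec.snd) Primrec.fst).of_eq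
    fun p => addressFrom_eq D p.1 p.2 p.1 le_rfl

theorem primrec_reorient {D : ℕ → ℕ → Bool} (hD : Primrec₂ D) : Primrec₂ (reorient D) := by
  have hn : Primrec fun p : ℕ × ℕ => p.1 + p.2 + 1 :=
    Primrec.succ.comp (Primrec.nat_add.comp Primrec.fst Primrec.snd)
  exact Primrec.and.comp
    (Primrec.or.comp (hD.comp Primrec.fst Primrec.snd) (hD.comp Primrec.snd Primrec.fst))
    (Primrec.nat_lt.decide.comp ((primrec_address hD).comp hn Primrec.fst)
      ((primrec_address hD).comp hn Primrec.snd))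

/-! ### Comparing addresses -/

variable {D : ℕ → ℕ → Bool}

theorem side_le (z x : ℕ) : side D z x ≤ 2 := by
  unfold side
  cases D x z <;> cases D z x <;> simp

theorem side_eq_zero {z x : ℕ} : side D z x = 0 ↔ D x z = true := by
  unfold side
  cases D x z <;> cases D z x <;> simp

theorem side_eq_one {z x : ℕ} : side D z x = 1 ↔ D x z = false ∧ D z x = false := by
  unfold side
  cases D x z <;> cases D z x <;> simp

theorem side_eq_two {z x : ℕ} : side D z x = 2 ↔ D x z = false ∧ D z x = true := by
  unfold side
  cases D x z <;> cases D z x <;> simp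

theorem address_succ_lt {z x y : ℕ} (h : address D z x < address D z y) :
    address D (z + 1) x < address D (z + 1) y := by
  have hx := side_le (D := D) z x
  simp only [address]
  split_ifs <;> lia

theorem address_lt_mono {m n x y : ℕ} (hmn : m ≤ n) (h : address D m x < address D m y) :
    address D n x < address D n y := by
  induction hmn with
  | refl => exact h
  | step _ ih => exact address_succ_lt ih

theorem address_le_of_le {m n x y : ℕ} (hmn : m ≤ n) (h : address D n x ≤ address D n y) :
    address D m x ≤ address D m y := by
  by_contra! hlt
  exact absurd (address_lt_mono hmn hlt) (not_lt.2 h)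

theorem address_eq_of_le {m n x y : ℕ} (hmn : m ≤ n) (h : address D n x = address D n y) :
    address D m x = address D m y :=
  le_antisymm (address_le_of_le hmn h.le) (address_le_of_le hmn h.ge)

/-- Two vertices sharing an address at step `z` but not at step `z + 1` are in the cell
of the pivot `z`, and are compared by their sides of `z`. -/
theorem side_lt_of_address {z x y : ℕ} (he : address D z x = address D z y)
    (hlt : address D (z + 1) x < address D (z + 1) y) :
    address D z z = address D z x ∧ side D z x < side D z y := by
  simp only [address, ← he] at hlt
  split_ifs at hlt with h
  · exact ⟨h, by lia⟩
  · lia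

/-- Vertices with different addresses at step `n` are separated by some pivot. -/
theorem exists_pivot {m n x y : ℕ} (he : address D m x = address D m y)
    (hlt : address D n x < address D n y) :
    ∃ z, m ≤ z ∧ z < n ∧ address D z x = address D z y ∧
      address D (z + 1) x < address D (z + 1) y := by
  induction n with
  | zero => simp [address] at hlt
  | succ n ih =>
    by_cases h : address D n x < address D n y
    · obtain ⟨z, h1, h2, h3⟩ := ih h
      exact ⟨z, h1, by lia, h3⟩
    · have hle := address_le_of_le (Nat.le_succ n) hlt.le
      refine ⟨n, ?_, by lia, by lia, hlt⟩
      by_contra! hnm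
      exact hlt.ne (address_eq_of_le hnm he)

theorem side_eq_of_address {z w x : ℕ} (hz : address D z z = address D z x)
    (h : address D (z + 1) w = address D (z + 1) x) : side D z w = side D z x := by
  have he := address_eq_of_le (Nat.le_succ z) h
  simp only [address, he, hz, if_true] at h
  lia

theorem address_ne_of_adj (hirrefl : ∀ x, D x x = false) {n x y : ℕ} (hn : x < n)
    (hadj : D x y = true ∨ D y x = true) : address D n x ≠ address D n y := by
  intro h
  have h' := address_eq_of_le (Nat.succ_le_of_lt hn) h
  have hs := side_eq_of_address (address_eq_of_le (Nat.le_succ x) h') h'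
  rw [side_eq_one.2 ⟨hirrefl x, hirrefl x⟩, eq_comm, side_eq_one] at hs
  simp_all

theorem reorient_iff (hirrefl : ∀ x, D x x = false) {n x y : ℕ} (hn : x + y < n) :
    reorient D x y = true ↔
      (D x y = true ∨ D y x = true) ∧ address D n x < address D n y := by
  simp only [reorient, Bool.and_eq_true, Bool.or_eq_true, decide_eq_true_eq]
  refine and_congr_right fun hadj => ⟨address_lt_mono hn, fun h => ?_⟩
  exact lt_of_le_of_ne (address_le_of_le hn h.le)
    (address_ne_of_adj hirrefl (by lia) hadj)

/-! ### Transitivity -/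

/-- An edge reversed by quicksort lies in a cyclic triangle with the pivot separating its ends. -/
theorem exists_cyclic_triangle (horient : ∀ x y, ¬(D x y = true ∧ D y x = true))
    (hpseudo : ∀ a b c, D a b = true → D b c = true → D a c = true ∨ D c a = true)
    {m n x y : ℕ} (hadj : D x y = true ∨ D y x = true)
    (he : address D m x = address D m y) (hlt : address D n x < address D n y) :
    D x y = true ∨
      ∃ w, address D m w = address D m x ∧ D x w = true ∧ D w y = true := by
  obtain ⟨w, hmw, -, hw, hlt'⟩ := exists_pivot he hlt
  obtain ⟨hc, hs⟩ := side_lt_of_address hw hlt'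
  have hcm := address_eq_of_le hmw hc
  have hx := side_le (D := D) w x
  have hy := side_le (D := D) w y
  have hx0 := side_eq_zero (D := D) (z := w) (x := x)
  have hx1 := side_eq_one (D := D) (z := w) (x := x)
  have hy1 := side_eq_one (D := D) (z := w) (x := y)
  have hy2 := side_eq_two (D := D) (z := w) (x := y)
  have o := horient x y
  have p1 := hpseudo y x w
  have p2 := hpseudo w y x
  by_cases hxy : D x y = true
  · exact Or.inl hxy
  · refine Or.inr ⟨w, hcm, ?_⟩
    grind

theorem adj_of_address_lt (horient : ∀ x y, ¬(D x y = true ∧ D y x = true))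
    (hpseudo : ∀ a b c, D a b = true → D b c = true → D a c = true ∨ D c a = true)
    {n a b c : ℕ} (hab : D a b = true ∨ D b a = true) (hbc : D b c = true ∨ D c b = true)
    (hltab : address D n a < address D n b) (hltbc : address D n b < address D n c) :
    D a c = true ∨ D c a = true := by
  obtain ⟨z, -, hzn, hz, hlt⟩ :=
    exists_pivot (m := 0) (by simp [address]) (hltab.trans hltbc)
  have hab' := address_le_of_le (Nat.le_of_lt hzn) hltab.le
  have hbc' := address_le_of_le (Nat.le_of_lt hzn) hltbc.le
  have hzab : address D z a = address D z b := by lia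
  obtain ⟨hc, hs⟩ := side_lt_of_address hz hlt
  have hsab := address_le_of_le hzn hltab.le
  have hsbc := address_le_of_le hzn hltbc.le
  simp only [address, ← hzab, ← hz, hc, if_true] at hsab hsbc
  have tab : side D z a = side D z b → D a b = true ∨
      ∃ w, side D z w = side D z a ∧ D a w = true ∧ D w b = true := fun h => by
    have he : address D (z + 1) a = address D (z + 1) b := by
      simp [address, ← hzab, hc, h]
    refine (exists_cyclic_triangle horient hpseudo hab he hltab).imp_right ?_
    rintro ⟨w, hw, h⟩
    exact ⟨w, side_eq_of_address hc hw, h⟩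
  have tbc : side D z b = side D z c → D b c = true ∨
      ∃ w, side D z w = side D z b ∧ D b w = true ∧ D w c = true := fun h => by
    have he : address D (z + 1) b = address D (z + 1) c := by
      simp [address, ← hzab, ← hz, hc, h]
    refine (exists_cyclic_triangle horient hpseudo hbc he hltbc).imp_right ?_
    rintro ⟨w, hw, h⟩
    exact ⟨w, side_eq_of_address (hc.trans hzab) hw, h⟩
  have hsc := side_le (D := D) z c
  have hcases : (side D z a = 0 ∧ side D z c = 2) ∨
      (side D z a = 0 ∧ side D z b = 0 ∧ side D z c = 1) ∨
      (side D z a = 0 ∧ side D z b = 1 ∧ side D z c = 1) ∨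
      (side D z a = 1 ∧ side D z b = 1 ∧ side D z c = 2) ∨
      (side D z a = 1 ∧ side D z b = 2 ∧ side D z c = 2) := by lia
  rcases hcases with ⟨ha, hc⟩ | ⟨ha, hb, hc⟩ | ⟨ha, hb, hc⟩ | ⟨ha, hb, hc⟩ | ⟨ha, hb, hc⟩
  · exact hpseudo a z c (side_eq_zero.1 ha) (side_eq_two.1 hc).2
  · have tab := tab (by lia)
    rw [ha] at tab
    simp only [side_eq_zero, side_eq_one] at ha hb hc tab
    grind
  · have tbc := tbc (by lia)
    rw [hb] at tbc
    simp only [side_eq_zero, side_eq_one] at ha hb hc tbc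
    grind
  · have tab := tab (by lia)
    rw [ha] at tab
    simp only [side_eq_two, side_eq_one] at ha hb hc tab
    grind
  · have tbc := tbc (by lia)
    rw [hb] at tbc
    simp only [side_eq_two, side_eq_one] at ha hb hc tbc
    grind

end Reorientation

open Reorientation

theorem stmt15 (D : ℕ → ℕ → Bool) (hD : Primrec₂ D)
    (hirrefl : ∀ x, D x x = false)
    (horient : ∀ x y, ¬(D x y = true ∧ D y x = true))
    (hpseudo : ∀ a b c, D a b = true → D b c = true → D a c = true ∨ D c a = true) :
    ∃ R : ℕ → ℕ → Bool, Primrec₂ R ∧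
      (∀ x y, ¬(R x y = true ∧ R y x = true)) ∧
      (∀ a b c, R a b = true → R b c = true → R a c = true) ∧
      (∀ x y, D x y = true → R x y = true ∨ R y x = true) ∧
      (∀ x y, R x y = true → D x y = true ∨ D y x = true) := by
  refine ⟨reorient D, primrec_reorient hD, ?_, ?_, ?_, ?_⟩
  · rintro x y ⟨hxy, hyx⟩
    rw [reorient_iff hirrefl (n := x + y + 1) (by lia)] at hxy hyx
    exact lt_asymm hxy.2 hyx.2
  · intro a b c hab hbc
    rw [reorient_iff hirrefl (n := a + b + c + 1) (by lia)] at hab hbc ⊢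
    exact ⟨adj_of_address_lt horient hpseudo hab.1 hbc.1 hab.2 hbc.2, hab.2.trans hbc.2⟩
  · intro x y hxy
    rw [reorient_iff hirrefl (n := x + y + 1) (by lia),
      reorient_iff hirrefl (n := x + y + 1) (by lia)]
    rcases lt_or_gt_of_ne (address_ne_of_adj hirrefl (n := x + y + 1) (by lia) (Or.inl hxy))
      with h | h
    · exact Or.inl ⟨Or.inl hxy, h⟩
    · exact Or.inr ⟨Or.inr hxy, h⟩
  · intro x y hxy
    exact ((reorient_iff hirrefl (Nat.lt_succ_self _)).1 hxy).1
end

section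
/- Rival–Sands theorem for honestly presented graphs holds primitively recursively: let E : ℕ → ℕ → Bool be primitive recursive, symmetric and irreflexive, and let b : ℕ → List ℕ be primitive recursive such that for every x, the list b x contains exactly the neighbours of x (y ∈ b x ↔ E x y = true), so the graph is locally finite. Then there exists a primitive recursive strictly increasing x : ℕ → ℕ such that every vertex v ∈ ℕ is adjacent to at most one element of the range of x. -/
/-- Summing a list of natural numbers is primitive recursive. -/
theorem primrec_list_sum : Primrec (List.sum : List ℕ → ℕ) :=
  (Primrec.list_foldr Primrec.id (Primrec.const 0)
    (Primrec.nat_add.comp (Primrec.fst.comp Primrec.snd) (Primrec.snd.comp Primrec.snd)).to₂).of_eq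
    fun _ => rfl

/-- A number exceeding `u` and every vertex joined to `u` by a walk of length two, where `b` lists
the neighbours of each vertex. -/
def twoStepBound (b : ℕ → List ℕ) (u : ℕ) : ℕ :=
  u + ((b u).flatMap b).sum + 1

theorem Primrec.twoStepBound {b : ℕ → List ℕ} (hb : Primrec b) : Primrec (twoStepBound b) :=
  Primrec.succ.comp <| Primrec.nat_add.comp Primrec.id <|
    primrec_list_sum.comp <| Primrec.list_flatMap hb (hb.comp Primrec.snd).to₂

theorem lt_twoStepBound_self (b : ℕ → List ℕ) (u : ℕ) : u < twoStepBound b u := by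
  unfold twoStepBound
  omega

theorem lt_twoStepBound {b : ℕ → List ℕ} {u v w : ℕ} (hv : v ∈ b u) (hw : w ∈ b v) :
    w < twoStepBound b u := by
  have hle : w ≤ ((b u).flatMap b).sum :=
    List.le_sum_of_mem (List.mem_flatMap.2 ⟨v, hv, hw⟩)
  unfold twoStepBound
  omega

theorem stmt16 (E : ℕ → ℕ → Bool) (hE : Primrec₂ E)
    (hsymm : ∀ u v, E u v = E v u) (hirrefl : ∀ u, E u u = false)
    (b : ℕ → List ℕ) (hb : Primrec b)
    (hnbhd : ∀ u v, v ∈ b u ↔ E u v = true) :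
    ∃ x : ℕ → ℕ, Primrec x ∧ StrictMono x ∧
      ∀ v u w : ℕ, u ∈ Set.range x → w ∈ Set.range x →
        E v u = true → E v w = true → u = w := by
  let x : ℕ → ℕ := fun n => (twoStepBound b)^[n] 0
  have x_succ (n : ℕ) : x (n + 1) = twoStepBound b (x n) :=
    Function.iterate_succ_apply' _ _ _
  have x_mono : StrictMono x :=
    strictMono_nat_of_lt_succ fun n => x_succ n ▸ lt_twoStepBound_self b (x n)
  have index_not_lt {v i j : ℕ} (hi : E v (x i) = true) (hj : E v (x j) = true) : ¬ i < j := by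
    intro hij
    have hlt : x j < x (i + 1) := x_succ i ▸
      lt_twoStepBound ((hnbhd _ v).2 (hsymm v (x i) ▸ hi)) ((hnbhd v _).2 hj)
    exact hlt.not_ge (x_mono.monotone hij)
  refine ⟨x, Primrec.nat_iterate Primrec.id (Primrec.const 0)
    (hb.twoStepBound.comp Primrec.snd).to₂, x_mono, ?_⟩
  rintro v _ _ ⟨i, rfl⟩ ⟨j, rfl⟩ hi hj
  exact congrArg x (le_antisymm (not_lt.1 (index_not_lt hj hi)) (not_lt.1 (index_not_lt hi hj)))
end

section
/- Schmerl's colouring theorem holds primitively recursively: let n ≥ 1, let E : ℕ → ℕ → Bool be primitive recursive, symmetric and irreflexive, and let b : ℕ → List ℕ be primitive recursive such that for every x, the list b x contains exactly the neighbours of x (y ∈ b x ↔ E x y = true). Suppose every finite subgraph is n-colourable: for every finite F ⊆ ℕ there is c : ℕ → Fin n with c u ≠ c v whenever u, v ∈ F and E u v = true. Then there exists a primitive recursive c : ℕ → Fin (2*n − 1) which is a proper colouring of the whole graph: E u v = true → c u ≠ c v. -/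
namespace Schmerl

/-! ### Stages and layers -/

/-- An initial segment bound that absorbs all neighbours of the vertices below `N`. -/
def absorb (b : ℕ → List ℕ) (N : ℕ) : ℕ :=
  N + ((List.range N).flatMap b).foldr max 0 + 1

/-- An increasing sequence of bounds, each absorbing the neighbours of the previous segment. -/
def stage (b : ℕ → List ℕ) : ℕ → ℕ :=
  Nat.rec 0 fun _ N => absorb b N

/-- The index of the stage interval `[stage b j, stage b (j + 1))` containing `x`. -/
def layer (b : ℕ → List ℕ) (x : ℕ) : ℕ :=
  x.findGreatest fun j => stage b j ≤ x

theorem le_foldr_max {l : List ℕ} {y : ℕ} (h : y ∈ l) : y ≤ l.foldr max 0 := by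
  induction l with
  | nil => simp at h
  | cons a l ih =>
    rcases List.mem_cons.1 h with rfl | h
    · simp
    · exact (ih h).trans (by simp)

theorem lt_absorb {b : ℕ → List ℕ} {N x y : ℕ} (hx : x < N) (hy : y ∈ b x) :
    y < absorb b N := by
  have : y ≤ ((List.range N).flatMap b).foldr max 0 :=
    le_foldr_max (List.mem_flatMap.2 ⟨x, List.mem_range.2 hx, hy⟩)
  unfold absorb
  omega

theorem stage_succ (b : ℕ → List ℕ) (j : ℕ) : stage b (j + 1) = absorb b (stage b j) := rfl

theorem stage_strictMono (b : ℕ → List ℕ) : StrictMono (stage b) :=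
  strictMono_nat_of_lt_succ fun j => by
    rw [stage_succ, absorb]
    omega

theorem layer_lt_iff {b : ℕ → List ℕ} {x j : ℕ} : layer b x < j ↔ x < stage b j := by
  rw [← not_le, ← not_le, not_iff_not]
  have hspec : stage b (layer b x) ≤ x :=
    Nat.findGreatest_spec (P := fun j => stage b j ≤ x) (Nat.zero_le x) (Nat.zero_le x)
  exact ⟨fun h => ((stage_strictMono b).monotone h).trans hspec,
    fun h => Nat.le_findGreatest (((stage_strictMono b).le_apply).trans h) h⟩

theorem layer_le_succ {b : ℕ → List ℕ} {x y : ℕ} (hy : y ∈ b x) :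
    layer b y ≤ layer b x + 1 := by
  have hx : x < stage b (layer b x + 1) := layer_lt_iff.1 (Nat.lt_succ_self _)
  exact Nat.lt_succ_iff.1 (layer_lt_iff.2 (lt_absorb hx hy))

theorem primrec_stage {b : ℕ → List ℕ} (hb : Primrec b) : Primrec (stage b) := by
  have habsorb : Primrec (absorb b) :=
    Primrec.succ.comp (Primrec.nat_add.comp .id
      (Primrec.list_foldr (Primrec.list_flatMap Primrec.list_range (hb.comp Primrec.snd).to₂)
        (Primrec.const 0)
        (Primrec.nat_max.comp (Primrec.fst.comp Primrec.snd) (Primrec.snd.comp Primrec.snd)).to₂))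
  exact Primrec.nat_rec₁ 0 (habsorb.comp Primrec.snd).to₂

theorem primrec_layer {b : ℕ → List ℕ} (hb : Primrec b) : Primrec (layer b) :=
  Primrec.nat_findGreatest .id
    (Primrec.nat_le.comp ((primrec_stage hb).comp Primrec.snd) Primrec.fst)

/-! ### Colourings of finite initial segments -/

/-- The digits of `m` in base `n`, used to code colourings of initial segments of `ℕ`. -/
def digit (n m x : ℕ) : ℕ := m / n ^ x % n

/-- The base-`n` digits of `m` properly colour the graph `E` restricted to `[0, N)`. -/
def IsColouringCode (n : ℕ) (E : ℕ → ℕ → Bool) (N m : ℕ) : Prop :=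
  ∀ u < N, ∀ v < N, E u v = true → digit n m u ≠ digit n m v

open Classical in
/-- A code of a proper colouring of the graph restricted to `[0, N)`, if there is one. -/
noncomputable def colouringCode (n : ℕ) (E : ℕ → ℕ → Bool) (N : ℕ) : ℕ :=
  (n ^ N).findGreatest (IsColouringCode n E N)

theorem exists_digit_eq {n : ℕ} (c : ℕ → Fin n) (N : ℕ) :
    ∃ m < n ^ N, ∀ x < N, digit n m x = c x := by
  induction N with
  | zero => exact ⟨0, by simp⟩
  | succ N ih =>
    obtain ⟨m, hm, hdigit⟩ := ih
    have hc := (c N).isLt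
    have hn : 0 < n := by omega
    refine ⟨m + n ^ N * c N, ?_, fun x hx => ?_⟩
    · calc m + n ^ N * c N < n ^ N * (c N + 1) := by rw [mul_add]; omega
        _ ≤ n ^ (N + 1) := by rw [pow_succ]; exact Nat.mul_le_mul_left _ hc
    · rcases Nat.lt_succ_iff_lt_or_eq.1 hx with hx | rfl
      · obtain ⟨d, rfl⟩ := Nat.exists_eq_add_of_lt hx
        rw [← hdigit x hx, digit, digit,
          show n ^ (x + d + 1) * (c (x + d + 1) : ℕ) = n ^ x * (n * (n ^ d * c (x + d + 1))) by
            ring,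
          Nat.add_mul_div_left _ _ (pow_pos hn x), Nat.add_mul_mod_self_left]
      · rw [digit, Nat.add_mul_div_left _ _ (pow_pos hn x), Nat.div_eq_of_lt hm, zero_add,
          Nat.mod_eq_of_lt hc]

theorem isColouringCode_colouringCode {n : ℕ} {E : ℕ → ℕ → Bool}
    (hfin : ∀ F : Finset ℕ, ∃ c : ℕ → Fin n, ∀ u ∈ F, ∀ v ∈ F, E u v = true → c u ≠ c v)
    (N : ℕ) : IsColouringCode n E N (colouringCode n E N) := by
  classical
  obtain ⟨c, hc⟩ := hfin (Finset.range N)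
  obtain ⟨m, hm, hdigit⟩ := exists_digit_eq c N
  refine Nat.findGreatest_spec (P := IsColouringCode n E N) hm.le fun u hu v hv huv => ?_
  rw [hdigit u hu, hdigit v hv]
  exact fun h => hc u (by simpa using hu) v (by simpa using hv) huv (Fin.ext h)

theorem primrec_pow (n : ℕ) : Primrec fun x : ℕ => n ^ x :=
  (Primrec.nat_rec₁ 1 (f := fun _ r => r * n)
    (Primrec.nat_mul.comp Primrec.snd (Primrec.const n)).to₂).of_eq fun x => by
      induction x with
      | zero => rfl
      | succ x ih => rw [pow_succ, ← ih]

theorem primrec_digit (n : ℕ) : Primrec₂ (digit n) :=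
  Primrec.nat_mod.comp
    (Primrec.nat_div.comp Primrec.fst ((primrec_pow n).comp Primrec.snd)) (Primrec.const n)

theorem primrecRel_forall_lt {α : Type*} [Primcodable α] {R : ℕ → α → Prop}
    (hR : PrimrecRel R) : PrimrecRel fun (N : ℕ) (a : α) => ∀ x < N, R x a :=
  (hR.forall_mem_list.comp (Primrec.list_range.comp Primrec.fst) Primrec.snd).of_eq (by simp)

theorem primrecRel_isColouringCode (n : ℕ) {E : ℕ → ℕ → Bool} (hE : Primrec₂ E) :
    PrimrecRel (IsColouringCode n E) := by
  have hedge : PrimrecRel fun (v : ℕ) (p : ℕ × ℕ) =>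
      ¬ (E p.1 v = true ∧ digit n p.2 p.1 = digit n p.2 v) := by
    have hu : Primrec fun q : ℕ × ℕ × ℕ => q.2.1 := Primrec.fst.comp Primrec.snd
    have hm : Primrec fun q : ℕ × ℕ × ℕ => q.2.2 := Primrec.snd.comp Primrec.snd
    exact ((Primrec.eq.comp (hE.comp hu Primrec.fst) (Primrec.const true)).and
      (Primrec.eq.comp ((primrec_digit n).comp hm hu)
        ((primrec_digit n).comp hm Primrec.fst))).not
  have hinner : PrimrecRel fun (u : ℕ) (p : ℕ × ℕ) =>
      ∀ v < p.1, ¬ (E u v = true ∧ digit n p.2 u = digit n p.2 v) :=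
    (primrecRel_forall_lt hedge).comp (Primrec.fst.comp Primrec.snd)
      (Primrec.pair Primrec.fst (Primrec.snd.comp Primrec.snd))
  exact ((primrecRel_forall_lt hinner).comp Primrec.fst .id).of_eq fun p => by
    simp [IsColouringCode]

theorem primrec_colouringCode (n : ℕ) {E : ℕ → ℕ → Bool} (hE : Primrec₂ E) :
    Primrec (colouringCode n E) := by
  classical
  exact Primrec.nat_findGreatest (primrec_pow n) (primrecRel_isColouringCode n hE)

/-! ### Blending the finite colourings -/

/-- Two palettes of `n` colours inside `[0, 2 * n - 1)`, sharing exactly the colour `0`;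
the parity of `k` selects the palette. -/
def palette (n k a : ℕ) : ℕ :=
  if a = 0 then 0 else if k % 2 = 0 then a else n - 1 + a

/-- Even layers `2 * k` use the colouring `c k`. On an odd layer `2 * k + 1`, the vertices of
colour `0` in `c k` switch to the colouring `c (k + 1)`. -/
def blend (n : ℕ) (ℓ : ℕ → ℕ) (c : ℕ → ℕ → ℕ) (x : ℕ) : ℕ :=
  if ℓ x % 2 = 0 ∨ c (ℓ x / 2) x ≠ 0 then palette n (ℓ x / 2) (c (ℓ x / 2) x)
  else palette n (ℓ x / 2 + 1) (c (ℓ x / 2 + 1) x)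

theorem palette_lt {n a : ℕ} (k : ℕ) (ha : a < n) : palette n k a < 2 * n - 1 := by
  unfold palette
  split_ifs <;> omega

theorem blend_lt {n : ℕ} {ℓ : ℕ → ℕ} {c : ℕ → ℕ → ℕ} (hc : ∀ k x, c k x < n) (x : ℕ) :
    blend n ℓ c x < 2 * n - 1 := by
  unfold blend
  split_ifs <;> exact palette_lt _ (hc _ _)

theorem blend_ne_of_layer_le {n : ℕ} {ℓ : ℕ → ℕ} {c : ℕ → ℕ → ℕ} (hc : ∀ k x, c k x < n)
    {u v : ℕ} (huv : ℓ u ≤ ℓ v) (hvu : ℓ v ≤ ℓ u + 1)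
    (hproper : ∀ k, ℓ v ≤ 2 * k + 1 → c k u ≠ c k v) :
    blend n ℓ c u ≠ blend n ℓ c v := by
  have hstep : ℓ v = ℓ u ∨ ℓ v = ℓ u + 1 := by omega
  obtain ⟨k, hk | hk⟩ : ∃ k, ℓ u = 2 * k ∨ ℓ u = 2 * k + 1 := ⟨ℓ u / 2, by omega⟩
  · have hdiv : ℓ u / 2 = k ∧ ℓ v / 2 = k := by omega
    have := hproper k (by omega)
    have := hproper (k + 1) (by omega)
    have := hc k u
    have := hc k v
    have := hc (k + 1) u
    have := hc (k + 1) v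
    simp only [blend, palette, hdiv]
    split_ifs <;> omega
  · have := hproper (k + 1) (by omega)
    have := hc k u
    have := hc (k + 1) u
    have := hc (k + 1) v
    rcases hstep with hv | hv
    · have hdiv : ℓ u / 2 = k ∧ ℓ v / 2 = k := by omega
      have := hproper k (by omega)
      have := hc k v
      simp only [blend, palette, hdiv]
      split_ifs <;> omega
    · have hdiv : ℓ u / 2 = k ∧ ℓ v / 2 = k + 1 := by omega
      simp only [blend, palette, hdiv]
      split_ifs <;> omega

theorem primrec_palette (n : ℕ) : Primrec₂ (palette n) :=
  Primrec.ite (Primrec.eq.comp Primrec.snd (Primrec.const 0)) (Primrec.const 0)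
    (Primrec.ite
      (Primrec.eq.comp (Primrec.nat_mod.comp Primrec.fst (Primrec.const 2)) (Primrec.const 0))
      Primrec.snd (Primrec.nat_add.comp (Primrec.const (n - 1)) Primrec.snd))

theorem primrec_blend (n : ℕ) {ℓ : ℕ → ℕ} {c : ℕ → ℕ → ℕ} (hℓ : Primrec ℓ) (hc : Primrec₂ c) :
    Primrec (blend n ℓ c) := by
  have hhalf : Primrec fun x => ℓ x / 2 := Primrec.nat_div.comp hℓ (Primrec.const 2)
  have hhalf_succ : Primrec fun x => ℓ x / 2 + 1 := Primrec.succ.comp hhalf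
  have hcur : Primrec fun x => c (ℓ x / 2) x := hc.comp hhalf .id
  have hnext : Primrec fun x => c (ℓ x / 2 + 1) x := hc.comp hhalf_succ .id
  exact Primrec.ite
    ((Primrec.eq.comp (Primrec.nat_mod.comp hℓ (Primrec.const 2)) (Primrec.const 0)).or
      (Primrec.eq.comp hcur (Primrec.const 0)).not)
    ((primrec_palette n).comp hhalf hcur) ((primrec_palette n).comp hhalf_succ hnext)

end Schmerl

open Schmerl in
theorem stmt17 (n : ℕ) (hn : 1 ≤ n) (E : ℕ → ℕ → Bool) (hE : Primrec₂ E)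
    (hsymm : ∀ u v, E u v = E v u) (hirrefl : ∀ u, E u u = false)
    (b : ℕ → List ℕ) (hb : Primrec b)
    (hnbhd : ∀ u v, v ∈ b u ↔ E u v = true)
    (hfin : ∀ F : Finset ℕ, ∃ c : ℕ → Fin n,
      ∀ u ∈ F, ∀ v ∈ F, E u v = true → c u ≠ c v) :
    ∃ c : ℕ → Fin (2 * n - 1), Primrec c ∧
      ∀ u v : ℕ, E u v = true → c u ≠ c v := by
  let c : ℕ → ℕ → ℕ := fun k x => digit n (colouringCode n E (stage b (2 * k + 2))) x
  have hc : ∀ k x, c k x < n := fun k x => Nat.mod_lt _ hn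
  have hprim : Primrec₂ c :=
    (primrec_digit n).comp
      ((primrec_colouringCode n hE).comp ((primrec_stage hb).comp
        (Primrec.nat_add.comp (Primrec.nat_mul.comp (Primrec.const 2) Primrec.fst)
          (Primrec.const 2))))
      Primrec.snd
  have hproper : ∀ u v, layer b u ≤ layer b v → E u v = true →
      blend n (layer b) c u ≠ blend n (layer b) c v := fun u v hle huv =>
    blend_ne_of_layer_le hc hle (layer_le_succ ((hnbhd u v).2 huv)) fun k hk =>
      isColouringCode_colouringCode hfin _ u (layer_lt_iff.1 (by omega)) v
        (layer_lt_iff.1 (by omega)) huv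
  refine ⟨fun x => ⟨blend n (layer b) c x, blend_lt hc x⟩,
    Primrec.fin_val_iff.1 (primrec_blend n (primrec_layer hb) hprim), fun u v huv h => ?_⟩
  have heq : blend n (layer b) c u = blend n (layer b) c v := congrArg Fin.val h
  rcases le_total (layer b u) (layer b v) with hle | hle
  · exact hproper u v hle huv heq
  · exact hproper v u hle (hsymm u v ▸ huv) heq.symm
end

section
/- Let E : ℕ → ℕ → Bool be computable and symmetric, and say x and y are connected if x = y or there is a finite sequence x = z₀, z₁, …, z_m = y with E z_j z_{j+1} = true for all j < m. Suppose there is a finite list v₀, …, v_n of vertices such that every x ∈ ℕ is connected to some v_i. Then the connectivity relation is computable: the predicate on ℕ × ℕ given by (x, y) ↦ (x and y are connected) satisfies ComputablePred. -/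
/-- `x` and `y` are connected in the graph `(ℕ, E)`: either `x = y` or there
is a finite sequence of adjacent vertices from `x` to `y`. -/
def GraphConnected (E : ℕ → ℕ → Bool) (x y : ℕ) : Prop :=
  x = y ∨ ∃ (m : ℕ) (z : ℕ → ℕ), z 0 = x ∧ z m = y ∧
    ∀ j < m, E (z j) (z (j + 1)) = true

/-- Follow the list `l` from `x`, ignoring every entry of `l` that is not adjacent to the
vertex currently reached; only the first `n` entries are read. -/
def walkAlong (E : ℕ → ℕ → Bool) (x : ℕ) (l : List ℕ) (n : ℕ) : ℕ :=
  Nat.rec x (fun k a => bif E a (l[k]?.getD 0) then l[k]?.getD 0 else a) n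

theorem walkAlong_succ (E : ℕ → ℕ → Bool) (x : ℕ) (l : List ℕ) (n : ℕ) :
    walkAlong E x l (n + 1) =
      bif E (walkAlong E x l n) (l[n]?.getD 0) then l[n]?.getD 0 else walkAlong E x l n :=
  rfl

theorem walkAlong_computable {E : ℕ → ℕ → Bool} (hE : Computable₂ E) :
    Computable fun p : ℕ × List ℕ => walkAlong E p.1 p.2 p.2.length := by
  have hget : Computable fun q : (ℕ × List ℕ) × ℕ × ℕ => q.1.2[q.2.1]?.getD 0 :=
    Computable.option_getD
      (Computable.list_getElem?.comp (Computable.snd.comp Computable.fst)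
        (Computable.fst.comp Computable.snd))
      (Computable.const 0)
  have hlast : Computable fun q : (ℕ × List ℕ) × ℕ × ℕ => q.2.2 :=
    Computable.snd.comp Computable.snd
  exact Computable.nat_rec (Computable.list_length.comp Computable.snd) Computable.fst
    (Computable.cond (hE.comp hlast hget) hget hlast).to₂

/-- Connectivity is the reflexive transitive closure of adjacency. -/
theorem graphConnected_iff_reflTransGen {E : ℕ → ℕ → Bool} {x y : ℕ} :
    GraphConnected E x y ↔ Relation.ReflTransGen (fun a b => E a b = true) x y := by
  constructor
  · rintro (rfl | ⟨m, z, rfl, rfl, hz⟩)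
    · exact .refl
    · induction m with
      | zero => exact .refl
      | succ m ih => exact (ih fun j hj => hz j (by omega)).tail (hz m (by omega))
  · intro h
    induction h with
    | refl => exact .inl rfl
    | @tail b c _ hbc ih =>
      have hpath : ∃ (m : ℕ) (z : ℕ → ℕ), z 0 = x ∧ z m = b ∧
          ∀ j < m, E (z j) (z (j + 1)) = true := by
        rcases ih with rfl | ih
        · exact ⟨0, fun _ => x, rfl, rfl, by simp⟩
        · exact ih
      obtain ⟨m, z, h0, hm, hz⟩ := hpath
      refine .inr ⟨m + 1, fun j => if j ≤ m then z j else c, by simpa, by simp, fun j hj => ?_⟩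
      rcases Nat.lt_succ_iff_lt_or_eq.mp hj with hj | rfl
      · simpa [hj.le, Nat.succ_le_of_lt hj] using hz j hj
      · simpa [hm] using hbc

theorem reflTransGen_walkAlong (E : ℕ → ℕ → Bool) (x : ℕ) (l : List ℕ) (n : ℕ) :
    Relation.ReflTransGen (fun a b => E a b = true) x (walkAlong E x l n) := by
  induction n with
  | zero => exact .refl
  | succ n ih =>
    rw [walkAlong_succ]
    cases h : E (walkAlong E x l n) (l[n]?.getD 0)
    · exact ih
    · exact ih.tail h

theorem walkAlong_append {E : ℕ → ℕ → Bool} (x : ℕ) (l l' : List ℕ) {n : ℕ}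
    (hn : n ≤ l.length) : walkAlong E x (l ++ l') n = walkAlong E x l n := by
  induction n with
  | zero => rfl
  | succ n ih => rw [walkAlong_succ, walkAlong_succ, ih (by omega), List.getElem?_append_left hn]

theorem exists_walkAlong_eq {E : ℕ → ℕ → Bool} {x y : ℕ}
    (h : Relation.ReflTransGen (fun a b => E a b = true) x y) :
    ∃ l : List ℕ, walkAlong E x l l.length = y := by
  induction h with
  | refl => exact ⟨[], rfl⟩
  | @tail b c _ hbc ih =>
    obtain ⟨l, rfl⟩ := ih
    refine ⟨l ++ [c], ?_⟩
    rw [List.length_append, List.length_singleton, walkAlong_succ, walkAlong_append x l _ le_rfl]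
    simp [hbc]

theorem computablePred_mem_list {α : Type*} [Primcodable α] [DecidableEq α] (s : List α) :
    ComputablePred (· ∈ s) :=
  ((Primrec.eq.exists_mem_list.comp (Primrec.const s) Primrec.id).of_eq
    fun a => by simp).computablePred

/-- If every vertex is connected to some vertex of `v`, then such a vertex can be computed. -/
theorem exists_computable_representative {E : ℕ → ℕ → Bool} (hE : Computable₂ E) (v : List ℕ)
    (hcover : ∀ x, ∃ i ∈ v, Relation.ReflTransGen (fun a b => E a b = true) x i) :
    ∃ f : ℕ → ℕ, Computable f ∧
      ∀ x, f x ∈ v ∧ Relation.ReflTransGen (fun a b => E a b = true) x (f x) := by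
  have hend : Computable₂ fun x n : ℕ =>
      walkAlong E x (Denumerable.ofNat (List ℕ) n) (Denumerable.ofNat (List ℕ) n).length :=
    (walkAlong_computable hE).comp
      (Computable.fst.pair ((Computable.ofNat (List ℕ)).comp Computable.snd))
  set w : ℕ → ℕ → ℕ := fun x n =>
    walkAlong E x (Denumerable.ofNat (List ℕ) n) (Denumerable.ofNat (List ℕ) n).length
  have hex : ∀ x, ∃ n, w x n ∈ v := fun x => by
    obtain ⟨i, hi, hxi⟩ := hcover x
    obtain ⟨l, rfl⟩ := exists_walkAlong_eq hxi
    exact ⟨Encodable.encode l, by simpa [w] using hi⟩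
  have hfind : Computable fun x => Nat.find (hex x) :=
    Computable.find (P := fun x n => w x n ∈ v)
      ((computablePred_mem_list v).decide.comp hend).computablePred hex
  exact ⟨fun x => w x (Nat.find (hex x)), hend.comp Computable.id hfind,
    fun x => ⟨Nat.find_spec (hex x), reflTransGen_walkAlong E x _ _⟩⟩

theorem stmt18 (E : ℕ → ℕ → Bool) (hE : Computable₂ E)
    (hsymm : ∀ u v, E u v = E v u)
    (v : List ℕ) (hcover : ∀ x : ℕ, ∃ i ∈ v, GraphConnected E x i) :
    ComputablePred fun q : ℕ × ℕ => GraphConnected E q.1 q.2 := by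
  classical
  simp only [graphConnected_iff_reflTransGen] at hcover ⊢
  obtain ⟨f, hf, hfv⟩ := exists_computable_representative hE v hcover
  have hsymmGen : ∀ {a b}, Relation.ReflTransGen (fun a b => E a b = true) a b →
      Relation.ReflTransGen (fun a b => E a b = true) b a := fun h =>
    have : Std.Symm fun a b => E a b = true := ⟨fun a b hab => by rwa [hsymm]⟩
    Std.Symm.symm _ _ h
  let s : List (ℕ × ℕ) := (v ×ˢ v).filter fun p =>
    decide (Relation.ReflTransGen (fun a b => E a b = true) p.1 p.2)
  refine ((computablePred_mem_list s).decide.comp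
    ((hf.comp Computable.fst).pair (hf.comp Computable.snd))).computablePred.of_eq fun q => ?_
  have h1 := hfv q.1
  have h2 := hfv q.2
  have hmem : (f q.1, f q.2) ∈ v ×ˢ v := List.pair_mem_product.mpr ⟨h1.1, h2.1⟩
  simp only [s, decide_eq_true_eq, List.mem_filter, hmem, true_and]
  exact ⟨fun h => (h1.2.trans h).trans (hsymmGen h2.2),
    fun h => ((hsymmGen h1.2).trans h).trans h2.2⟩
end

section
/- For every computable g : ℕ → ℕ there exists a primitive recursive h : ℚ → ℕ → ℚ such that: (i) for every rational r with 0 ≤ r ≤ 1 and every i, |h r i − h r (i+1)| < 2^{-(i+1)}, so that f r := lim_{i→∞} ((h r i : ℝ)) exists; (ii) the function f is uniformly continuous on { r : ℚ | 0 ≤ r ≤ 1 }; and (iii) every modulus of uniform continuity of f dominates g: if m : ℕ → ℕ satisfies, for all n and all rationals r, r' in [0,1], |((r : ℝ)) − ((r' : ℝ))| < 2^{-m n} → |f r − f r'| < 2^{-n}, then m i > g i for all i. -/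
/-! ### Primitive recursive arithmetic on natural numbers -/

namespace Primrec

theorem nat_gcd : Primrec₂ Nat.gcd := by
  have dvd {f : (ℕ × ℕ) × ℕ → ℕ} (hf : Primrec f) :
      PrimrecPred fun x : (ℕ × ℕ) × ℕ => x.2 ∣ f x :=
    (Primrec.eq.comp (nat_mod.comp hf snd) (const 0)).of_eq fun x =>
      Nat.dvd_iff_mod_eq_zero.symm
  have hrel : PrimrecRel fun (x : ℕ × ℕ) (d : ℕ) => d ∣ x.1 ∧ d ∣ x.2 :=
    (dvd (fst.comp fst)).and (dvd (snd.comp fst))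
  refine (nat_findGreatest (nat_add.comp fst snd) hrel).of_eq fun ⟨a, b⟩ => ?_
  rw [Nat.findGreatest_eq_iff]
  refine ⟨?_, fun _ => ⟨Nat.gcd_dvd_left a b, Nat.gcd_dvd_right a b⟩, fun d hd hle hdvd => ?_⟩
  · rcases Nat.eq_zero_or_pos a with rfl | ha
    · simp
    · exact (Nat.gcd_le_left b ha).trans (Nat.le_add_right a b)
  · have hdvd' := Nat.dvd_gcd hdvd.1 hdvd.2
    rcases Nat.eq_zero_or_pos (a.gcd b) with h | h
    · obtain ⟨rfl, rfl⟩ := Nat.gcd_eq_zero_iff.1 h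
      simp at hle
      lia
    · exact hd.not_ge (Nat.le_of_dvd h hdvd')

theorem two_pow : Primrec fun n : ℕ => 2 ^ n :=
  (nat_rec₁ 1 (nat_mul.comp snd (const 2)).to₂).of_eq fun n => by
    induction n with
    | zero => rfl
    | succ n ih => rw [pow_succ, ← ih]

theorem nat_count {p : ℕ → Prop} [DecidablePred p] (hp : PrimrecPred p) :
    Primrec (Nat.count p) :=
  (nat_rec₁ 0 (nat_add.comp snd (ite (hp.comp fst) (const 1) (const 0))).to₂).of_eq fun n => by
    induction n with
    | zero => simp
    | succ n ih => rw [Nat.count_succ, ← ih]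

/-- The enumeration of a primitive recursive set containing the values of a strictly increasing
primitive recursive function is primitive recursive. -/
theorem nat_nth {p : ℕ → Prop} (hp : PrimrecPred p) {u : ℕ → ℕ} (hu : Primrec u)
    (hmono : StrictMono u) (hpu : ∀ n, p (u n)) : Primrec (Nat.nth p) := by
  classical
  have hinf : (Set.ofPred p).Infinite := Set.infinite_of_injective_forall_mem hmono.injective hpu
  refine of_graph ⟨u, hu, fun n => ?_⟩ ?_
  · have hcount : StrictMono fun n => Nat.count p (u n) := fun m n hmn =>
      Nat.count_strict_mono (hpu m) (hmono hmn)
    calc Nat.nth p n ≤ Nat.nth p (Nat.count p (u n)) := (Nat.nth_le_nth hinf).2 hcount.le_apply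
      _ = u n := Nat.nth_count (hpu n)
  · have hrel : PrimrecRel fun n c : ℕ => p c ∧ Nat.count p c = n :=
      (hp.comp snd).and (Primrec.eq.comp ((nat_count hp).comp snd) fst)
    refine hrel.of_eq fun n c => ⟨fun h => ?_, fun h => ?_⟩
    · rw [← h.2, Nat.nth_count h.1]
    · rw [← h]
      exact ⟨Nat.nth_mem_of_infinite hinf n, Nat.count_nth_of_infinite hinf n⟩

end Primrec

/-! ### Primitive recursive operations on rational numbers -/

namespace Rat

/-- The code of a rational number in the (non-surjective) encoding whose range is enumerated by
`Denumerable.eqv ℚ`. -/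
def code (r : ℚ) : ℕ := Nat.pair (Equiv.intEquivNat r.num) r.den

theorem code_eqv_symm (n : ℕ) :
    code ((Denumerable.eqv ℚ).symm n) = Nat.nth (· ∈ Set.range code) n := by
  have hinf : Infinite (Set.range (@Encodable.encode ℚ Rat.instEncodable)) :=
    Infinite.of_injective _ (Equiv.ofInjective _ Encodable.encode_injective).injective
  let _ := @Encodable.decidableRangeEncode ℚ Rat.instEncodable
  change _ = Nat.nth (· ∈ Set.range (@Encodable.encode ℚ Rat.instEncodable)) n
  rw [Nat.nth_apply_eq_orderIsoOfNat
    (p := (· ∈ Set.range (@Encodable.encode ℚ Rat.instEncodable))) (Set.infinite_coe_iff.1 hinf)]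
  have h := (@Encodable.equivRangeEncode ℚ Rat.instEncodable).apply_symm_apply
    (Nat.Subtype.ofNat (Set.range (@Encodable.encode ℚ Rat.instEncodable)) n)
  exact congrArg Subtype.val (h.trans Nat.Subtype.orderIsoOfNat_apply.symm)

theorem natAbs_eq_intEquivNat_div (z : ℤ) : z.natAbs = (Equiv.intEquivNat z + 1) / 2 := by
  cases z with
  | ofNat k => change k = (2 * k + 1) / 2; lia
  | negSucc k => change k + 1 = (2 * k + 1 + 1) / 2; lia

theorem mem_range_code_iff (c : ℕ) :
    c ∈ Set.range code ↔ 0 < c.unpair.2 ∧ ((c.unpair.1 + 1) / 2).gcd c.unpair.2 = 1 := by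
  constructor
  · rintro ⟨r, rfl⟩
    simpa [code, ← natAbs_eq_intEquivNat_div] using! ⟨r.pos, r.reduced⟩
  · rintro ⟨hpos, hcop⟩
    refine ⟨⟨Equiv.intEquivNat.symm c.unpair.1, c.unpair.2, hpos.ne', ?_⟩, ?_⟩
    · rwa [natAbs_eq_intEquivNat_div, Equiv.apply_symm_apply]
    · simp [code]

theorem primrecPred_mem_range_code : PrimrecPred (· ∈ Set.range code) := by
  have hfst : Primrec fun c : ℕ => c.unpair.1 := Primrec.fst.comp Primrec.unpair
  have hsnd : Primrec fun c : ℕ => c.unpair.2 := Primrec.snd.comp Primrec.unpair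
  exact ((Primrec.nat_lt.comp (Primrec.const 0) hsnd).and
    (Primrec.eq.comp (Primrec.nat_gcd.comp
      (Primrec.nat_div.comp (Primrec.succ.comp hfst) (Primrec.const 2)) hsnd)
      (Primrec.const 1))).of_eq fun c => (mem_range_code_iff c).symm

theorem code_natCast (n : ℕ) : code n = Nat.pair (2 * n) 1 := rfl

theorem strictMono_code_natCast : StrictMono fun n : ℕ => code n := fun m n hmn => by
  simpa only [code_natCast] using Nat.pair_lt_pair_left 1 (by lia)

theorem primrec_code : Primrec code := by
  have hu : Primrec fun n : ℕ => code n :=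
    Primrec₂.natPair.comp (Primrec.nat_mul.comp (Primrec.const 2) Primrec.id) (Primrec.const 1)
  have hnth : Primrec (Nat.nth (· ∈ Set.range code)) :=
    Primrec.nat_nth primrecPred_mem_range_code hu strictMono_code_natCast
      fun n => Set.mem_range_self _
  exact (hnth.comp (Primrec.of_equiv (e := Denumerable.eqv ℚ))).of_eq fun r => by
    rw [← code_eqv_symm, Equiv.symm_apply_apply]

theorem primrec_of_code {α : Type*} [Primcodable α] {f : α → ℚ}
    (hf : Primrec fun a => code (f a)) : Primrec f := by
  classical
  refine (Primrec.of_equiv_iff (Denumerable.eqv ℚ)).1 ?_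
  refine ((Primrec.nat_count primrecPred_mem_range_code).comp hf).of_eq fun a => ?_
  have hinf : (Set.ofPred (· ∈ Set.range code)).Infinite :=
    Set.infinite_of_injective_forall_mem strictMono_code_natCast.injective
      fun n => Set.mem_range_self _
  rw [← Nat.count_nth_of_infinite hinf (Denumerable.eqv ℚ (f a)), ← code_eqv_symm,
    Equiv.symm_apply_apply]

theorem primrec_den : Primrec Rat.den :=
  (Primrec.snd.comp (Primrec.unpair.comp primrec_code)).of_eq fun r => by simp [code]

theorem primrec_natAbs_num : Primrec fun r : ℚ => r.num.natAbs :=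
  (Primrec.nat_div.comp (Primrec.succ.comp (Primrec.fst.comp (Primrec.unpair.comp primrec_code)))
    (Primrec.const 2)).of_eq fun r => by simp [code, natAbs_eq_intEquivNat_div]

theorem code_natCast_div (a b : ℕ) (hb : 0 < b) :
    code ((a : ℚ) / b) = Nat.pair (2 * (a / a.gcd b)) (b / a.gcd b) := by
  have hpos : 0 < a.gcd b := Nat.gcd_pos_of_pos_right a hb
  have hcop : (a / a.gcd b).Coprime (b / a.gcd b) := Nat.coprime_div_gcd_div_gcd hpos
  have hden : 0 < b / a.gcd b := Nat.div_pos (Nat.gcd_le_right a hb) hpos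
  have heq : (a : ℚ) / b = ((a / a.gcd b : ℕ) : ℤ) / ((b / a.gcd b : ℕ) : ℤ) := by
    have ha' : (a : ℚ) = (a / a.gcd b : ℕ) * a.gcd b := by
      exact_mod_cast (Nat.div_mul_cancel (Nat.gcd_dvd_left a b)).symm
    have hb' : (b : ℚ) = (b / a.gcd b : ℕ) * a.gcd b := by
      exact_mod_cast (Nat.div_mul_cancel (Nat.gcd_dvd_right a b)).symm
    conv_lhs => rw [ha', hb']
    rw [mul_div_mul_right _ _ (by exact_mod_cast hpos.ne'), Int.cast_natCast, Int.cast_natCast]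
  have hnum := Rat.num_div_eq_of_coprime (a := ((a / a.gcd b : ℕ) : ℤ))
    (b := ((b / a.gcd b : ℕ) : ℤ)) (by exact_mod_cast hden) hcop
  have hden' := Rat.den_div_eq_of_coprime (a := ((a / a.gcd b : ℕ) : ℤ))
    (b := ((b / a.gcd b : ℕ) : ℤ)) (by exact_mod_cast hden) hcop
  rw [code, heq, hnum, Int.ofNat_inj.1 hden']
  rfl

theorem primrec_natCast_div {α : Type*} [Primcodable α] {a b : α → ℕ} (ha : Primrec a)
    (hb : Primrec b) (hpos : ∀ x, 0 < b x) : Primrec fun x => (a x : ℚ) / b x := by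
  have hgcd : Primrec fun x => (a x).gcd (b x) := Primrec.nat_gcd.comp ha hb
  exact primrec_of_code ((Primrec₂.natPair.comp
    (Primrec.nat_mul.comp (Primrec.const 2) (Primrec.nat_div.comp ha hgcd))
    (Primrec.nat_div.comp hb hgcd)).of_eq fun x => (code_natCast_div (a x) (b x) (hpos x)).symm)

end Rat

/-! ### Majorants of computable functions -/

/-- Every computable function lies below a function whose truncations are uniformly primitive
recursive. -/
theorem Computable.exists_lt_primrec_min {g : ℕ → ℕ} (hg : Computable g) :
    ∃ G : ℕ → ℕ, (∀ j, g j < G j) ∧ Primrec₂ fun j q => min (G j) q := by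
  obtain ⟨c, hc⟩ := Nat.Partrec.Code.exists_code.1 (Partrec.nat_iff.1 hg)
  have hval (j : ℕ) : g j ∈ c.eval j := by simp [hc]
  -- `y` bounds the running time of `c` on input `j` as well as its output
  let Q (j y : ℕ) : Prop := ∃ v ∈ Nat.Partrec.Code.evaln y c j, v < y
  have hex (j : ℕ) : ∃ y, Q j y := by
    obtain ⟨k, hk⟩ := Nat.Partrec.Code.evaln_complete.1 (hval j)
    exact ⟨k + g j + 1, g j, Nat.Partrec.Code.evaln_mono (by lia) hk, by lia⟩
  have hmono (j : ℕ) {y y' : ℕ} (hle : y ≤ y') : Q j y → Q j y' := fun ⟨v, hv, hlt⟩ =>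
    ⟨v, Nat.Partrec.Code.evaln_mono hle hv, hlt.trans_le hle⟩
  have hQ : PrimrecRel Q := by
    have hev : Primrec fun x : ℕ × ℕ => Nat.Partrec.Code.evaln x.2 c x.1 :=
      Nat.Partrec.Code.primrec_evaln.comp
        ((Primrec.snd.pair (Primrec.const c)).pair Primrec.fst)
    have hlt : Primrec₂ fun (x : ℕ × ℕ) (v : ℕ) => decide (v < x.2) :=
      (Primrec.nat_lt.comp Primrec.snd (Primrec.snd.comp Primrec.fst)).decide
    have hb := Primrec.option_casesOn hev (Primrec.const false) hlt
    refine (Primrec.eq.comp hb (Primrec.const true)).of_eq fun x => ?_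
    cases h : Nat.Partrec.Code.evaln x.2 c x.1 <;> simp [Q, h]
  classical
  obtain ⟨G, hG⟩ : ∃ G : ℕ → ℕ, ∀ j y, G j ≤ y ↔ Q j y :=
    ⟨fun j => Nat.find (hex j), fun j y =>
      ⟨fun h => hmono j h (Nat.find_spec (hex j)), Nat.find_min' (hex j)⟩⟩
  refine ⟨G, fun j => ?_, ?_⟩
  · obtain ⟨v, hv, hlt⟩ := (hG j _).1 le_rfl
    rwa [Part.mem_unique (hval j) (Nat.Partrec.Code.evaln_sound hv)]
  · have hrel : PrimrecRel fun (x : ℕ × ℕ) (y : ℕ) => y ≤ G x.1 := by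
      refine ((Primrec.eq.comp Primrec.snd (Primrec.const 0)).or
        (hQ.comp (Primrec.fst.comp Primrec.fst) (Primrec.pred.comp Primrec.snd)).not).of_eq
        fun x => ?_
      rw [← hG, Nat.pred_eq_sub_one]
      lia
    refine (Primrec.nat_findGreatest Primrec.snd hrel).of_eq fun x => ?_
    rw [Nat.findGreatest_eq_iff]
    refine ⟨min_le_right _ _, fun _ => min_le_left _ _, fun y hy hle => ?_⟩
    lia

/-! ### Superposition of ramps -/

/-- The ramp that vanishes up to `0`, has slope `2 ^ n` after that, and is cut off at height `1`. -/
noncomputable def ramp (n : ℕ) (x : ℝ) : ℝ := max 0 (min 1 (2 ^ n * x))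

theorem ramp_nonneg (n : ℕ) (x : ℝ) : 0 ≤ ramp n x := le_max_left _ _

theorem ramp_le_one (n : ℕ) (x : ℝ) : ramp n x ≤ 1 := max_le zero_le_one (min_le_left _ _)

theorem ramp_div_le (n j : ℕ) (x : ℝ) : ramp n x / 2 ^ j ≤ (1 / 2) ^ j := by
  rw [one_div_pow]
  gcongr
  exact ramp_le_one n x

theorem ramp_div_nonneg (n j : ℕ) (x : ℝ) : 0 ≤ ramp n x / 2 ^ j :=
  div_nonneg (ramp_nonneg n x) (by positivity)

theorem summable_ramp_div (G : ℕ → ℕ) (x : ℝ) : Summable fun j => ramp (G j) x / 2 ^ j :=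
  Summable.of_nonneg_of_le (fun j => ramp_div_nonneg (G j) j x)
    (fun j => ramp_div_le (G j) j x) summable_geometric_two

theorem continuous_tsum_ramp_div (G : ℕ → ℕ) :
    Continuous fun x => ∑' j, ramp (G j) x / 2 ^ j := by
  refine continuous_tsum (fun j => ?_) summable_geometric_two fun j x => ?_
  · unfold ramp
    fun_prop
  · rw [Real.norm_of_nonneg (ramp_div_nonneg (G j) j x)]
    exact ramp_div_le (G j) j x

theorem tsum_ramp_div_zero (G : ℕ → ℕ) : ∑' j, ramp (G j) 0 / 2 ^ j = 0 := by
  simp [ramp]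

theorem le_tsum_ramp_div (G : ℕ → ℕ) {i : ℕ} {x : ℝ} (hx : 1 ≤ 2 ^ G i * x) :
    1 / 2 ^ i ≤ ∑' j, ramp (G j) x / 2 ^ j := by
  have hi : ramp (G i) x = 1 := by simp [ramp, hx]
  simpa only [hi] using
    (summable_ramp_div G x).le_tsum i fun j _ => ramp_div_nonneg (G j) j x

/-- The numerator over the denominator `2 ^ k` of `∑ j < k, m j / 2 ^ j`. -/
def dyadicNumerator (m : ℕ → ℕ) : ℕ → ℕ
  | 0 => 0
  | k + 1 => 2 * dyadicNumerator m k + 2 * m k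

theorem dyadicNumerator_div (m : ℕ → ℕ) (k : ℕ) :
    (dyadicNumerator m k : ℚ) / 2 ^ k = ∑ j ∈ Finset.range k, (m j : ℚ) / 2 ^ j := by
  induction k with
  | zero => simp [dyadicNumerator]
  | succ k ih =>
    rw [Finset.sum_range_succ, ← ih, dyadicNumerator]
    push_cast
    field_simp
    ring

theorem Primrec.dyadicNumerator {α : Type*} [Primcodable α] {m : α → ℕ → ℕ} {k : α → ℕ}
    (hm : Primrec₂ m) (hk : Primrec k) : Primrec fun a => dyadicNumerator (m a) (k a) := by
  have hstep : Primrec₂ fun (a : α) (x : ℕ × ℕ) => 2 * x.2 + 2 * m a x.1 :=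
    Primrec.nat_add.comp
      (Primrec.nat_mul.comp (Primrec.const 2) (Primrec.snd.comp Primrec.snd))
      (Primrec.nat_mul.comp (Primrec.const 2)
        (hm.comp Primrec.fst (Primrec.fst.comp Primrec.snd)))
  refine (Primrec.nat_rec' hk (Primrec.const 0) hstep).of_eq fun a => ?_
  induction k a with
  | zero => rfl
  | succ k ih => simp only [_root_.dyadicNumerator, ← ih]

/-- The numerator of `ramp (G j) r` over the denominator of `r`, for nonnegative rationals `r`. It
depends on `G j` only through `min (G j) r.den`. -/
def rampNumerator (G : ℕ → ℕ) (r : ℚ) (j : ℕ) : ℕ :=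
  min r.den (2 ^ min (G j) r.den * r.num.natAbs)

theorem rampNumerator_eq (G : ℕ → ℕ) (r : ℚ) (j : ℕ) :
    rampNumerator G r j = min r.den (2 ^ G j * r.num.natAbs) := by
  rw [rampNumerator]
  rcases le_total (G j) r.den with h | h
  · rw [min_eq_left h]
  rw [min_eq_right h]
  rcases Nat.eq_zero_or_pos r.num.natAbs with h0 | h0
  · rw [h0, mul_zero, mul_zero]
  have hden : r.den ≤ 2 ^ r.den * r.num.natAbs :=
    Nat.lt_two_pow_self.le.trans (Nat.le_mul_of_pos_right _ h0)
  rw [min_eq_left hden, min_eq_left (hden.trans (by gcongr; norm_num))]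

theorem rampNumerator_div_den (G : ℕ → ℕ) {r : ℚ} (hr : 0 ≤ r) (j : ℕ) :
    ((rampNumerator G r j : ℕ) : ℝ) / r.den = ramp (G j) r := by
  have hden : (0 : ℝ) < r.den := by exact_mod_cast r.pos
  have hnum : (r.num.natAbs : ℝ) = r * r.den := by
    have hcast : ((r.num.natAbs : ℤ) : ℚ) = r * r.den := by
      rw [Int.natAbs_of_nonneg (Rat.num_nonneg.2 hr), Rat.mul_den_eq_num]
    rw [Int.cast_natCast] at hcast
    have hreal := congrArg (Rat.cast : ℚ → ℝ) hcast
    rwa [Rat.cast_natCast, Rat.cast_mul, Rat.cast_natCast] at hreal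
  have hr' : (0 : ℝ) ≤ r := by exact_mod_cast hr
  rw [rampNumerator_eq, ramp, max_eq_right (by positivity)]
  push_cast
  rw [hnum, ← min_div_div_right hden.le, div_self hden.ne', ← mul_assoc,
    mul_div_cancel_right₀ _ hden.ne']

/-- The partial sums, of `n + 2` terms, of the series `∑ j, ramp (G j) r / 2 ^ j`. -/
def rampSum (G : ℕ → ℕ) (r : ℚ) (n : ℕ) : ℚ :=
  (dyadicNumerator (rampNumerator G r) (n + 2) : ℚ) / (r.den * 2 ^ (n + 2) : ℕ)

theorem primrec_rampSum {G : ℕ → ℕ} (hG : Primrec₂ fun j q => min (G j) q) :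
    Primrec₂ (rampSum G) := by
  have hnum : Primrec₂ (rampNumerator G) := by
    have hden : Primrec fun x : ℚ × ℕ => x.1.den := Rat.primrec_den.comp Primrec.fst
    exact Primrec.nat_min.comp hden (Primrec.nat_mul.comp
      (Primrec.two_pow.comp (hG.comp Primrec.snd hden))
      (Rat.primrec_natAbs_num.comp Primrec.fst))
  have hk : Primrec fun x : ℚ × ℕ => x.2 + 2 := Primrec.nat_add.comp Primrec.snd (Primrec.const 2)
  exact Rat.primrec_natCast_div
    (Primrec.dyadicNumerator (m := fun x : ℚ × ℕ => rampNumerator G x.1)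
      (hnum.comp (Primrec.fst.comp Primrec.fst) Primrec.snd) hk)
    (Primrec.nat_mul.comp (Rat.primrec_den.comp Primrec.fst) (Primrec.two_pow.comp hk))
    fun x => Nat.mul_pos x.1.pos (by positivity)

theorem rampSum_eq (G : ℕ → ℕ) {r : ℚ} (hr : 0 ≤ r) (n : ℕ) :
    (rampSum G r n : ℝ) = ∑ j ∈ Finset.range (n + 2), ramp (G j) r / 2 ^ j := by
  have h : rampSum G r n =
      ∑ j ∈ Finset.range (n + 2), (rampNumerator G r j : ℚ) / r.den / 2 ^ j := by
    rw [rampSum, Nat.cast_mul, mul_comm, ← div_div, Nat.cast_pow, Nat.cast_ofNat,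
      dyadicNumerator_div, Finset.sum_div]
    exact Finset.sum_congr rfl fun j _ => div_right_comm _ _ _
  rw [h]
  push_cast
  exact Finset.sum_congr rfl fun j _ => by rw [rampNumerator_div_den G hr]

theorem abs_rampSum_sub_succ_lt (G : ℕ → ℕ) {r : ℚ} (hr : 0 ≤ r) (n : ℕ) :
    |rampSum G r n - rampSum G r (n + 1)| < 1 / 2 ^ (n + 1) := by
  have h : |(rampSum G r n : ℝ) - rampSum G r (n + 1)| < 1 / 2 ^ (n + 1) := by
    rw [rampSum_eq G hr, rampSum_eq G hr, Finset.sum_range_succ _ (n + 2), abs_sub_comm,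
      add_sub_cancel_left, abs_of_nonneg (ramp_div_nonneg _ _ _)]
    calc ramp (G (n + 2)) r / 2 ^ (n + 2) ≤ 1 / 2 ^ (n + 2) := by
          gcongr
          exact ramp_le_one _ _
      _ < 1 / 2 ^ (n + 1) := by
          gcongr <;> norm_num
  rw [← Rat.cast_lt (K := ℝ)]
  simpa using h

theorem tendsto_rampSum (G : ℕ → ℕ) {r : ℚ} (hr : 0 ≤ r) :
    Filter.Tendsto (fun n => (rampSum G r n : ℝ)) Filter.atTop
      (nhds (∑' j, ramp (G j) r / 2 ^ j)) := by
  simp only [rampSum_eq G hr]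
  exact (Filter.tendsto_add_atTop_iff_nat 2).2 (summable_ramp_div G r).hasSum.tendsto_sum_nat

theorem stmt19 (g : ℕ → ℕ) (hg : Computable g) :
    ∃ h : ℚ → ℕ → ℚ, Primrec₂ h ∧
      ∃ f : ℚ → ℝ,
        -- (i) the rate condition, making `i ↦ (h r i : ℝ)` a Cauchy sequence,
        (∀ r : ℚ, 0 ≤ r → r ≤ 1 →
          ∀ i : ℕ, |h r i - h r (i + 1)| < 1 / 2 ^ (i + 1)) ∧
        -- whose limit is `f r`,
        (∀ r : ℚ, 0 ≤ r → r ≤ 1 →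
          Filter.Tendsto (fun i : ℕ => ((h r i : ℝ))) Filter.atTop (nhds (f r))) ∧
        -- (ii) `f` is uniformly continuous on the rationals of `[0,1]`,
        (∀ ε : ℝ, 0 < ε → ∃ δ : ℝ, 0 < δ ∧
          ∀ r r' : ℚ, 0 ≤ r → r ≤ 1 → 0 ≤ r' → r' ≤ 1 →
            |(r : ℝ) - (r' : ℝ)| < δ → |f r - f r'| < ε) ∧
        -- (iii) every modulus of uniform continuity of `f` dominates `g`.
        (∀ m : ℕ → ℕ,
          (∀ n : ℕ, ∀ r r' : ℚ, 0 ≤ r → r ≤ 1 → 0 ≤ r' → r' ≤ 1 →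
            |(r : ℝ) - (r' : ℝ)| < 2 ^ (-(m n : ℤ)) → |f r - f r'| < 2 ^ (-(n : ℤ))) →
          ∀ i, g i < m i) := by
  obtain ⟨G, hgG, hG⟩ := hg.exists_lt_primrec_min
  refine ⟨rampSum G, primrec_rampSum hG, fun r => ∑' j, ramp (G j) r / 2 ^ j,
    fun r hr _ i => abs_rampSum_sub_succ_lt G hr i, fun r hr _ => tendsto_rampSum G hr, ?_, ?_⟩
  · intro ε hε
    have huc := isCompact_Icc.uniformContinuousOn_of_continuous (s := Set.Icc (0 : ℝ) 1)
      (continuous_tsum_ramp_div G).continuousOn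
    obtain ⟨δ, hδ, h⟩ := Metric.uniformContinuousOn_iff.1 huc ε hε
    exact ⟨δ, hδ, fun r r' h0 h1 h0' h1' hlt =>
      h r ⟨by exact_mod_cast h0, by exact_mod_cast h1⟩
        r' ⟨by exact_mod_cast h0', by exact_mod_cast h1'⟩ hlt⟩
  · intro m hm i
    by_contra! hle
    have hr0 : (0 : ℚ) ≤ 1 / 2 ^ G i := by positivity
    have hr1 : (1 : ℚ) / 2 ^ G i ≤ 1 :=
      div_le_one_of_le₀ (one_le_pow₀ one_le_two) (by positivity)
    have hclose : |((1 / 2 ^ G i : ℚ) : ℝ) - ((0 : ℚ) : ℝ)| < 2 ^ (-(m i : ℤ)) := by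
      rw [Rat.cast_zero, sub_zero, abs_of_nonneg (by exact_mod_cast hr0), zpow_neg, zpow_natCast,
        ← one_div]
      push_cast
      have hlt : m i < G i := hle.trans_lt (hgG i)
      gcongr
      norm_num
    have hlt := hm i (1 / 2 ^ G i) 0 hr0 hr1 le_rfl zero_le_one hclose
    have hlow := le_tsum_ramp_div G (i := i) (x := ((1 / 2 ^ G i : ℚ) : ℝ)) (by
      push_cast
      rw [mul_one_div_cancel (by positivity)])
    beta_reduce at hlt
    rw [Rat.cast_zero, tsum_ramp_div_zero, sub_zero, zpow_neg, zpow_natCast, ← one_div] at hlt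
    exact (hlow.trans (le_abs_self _)).not_gt hlt
end
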